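/- For every ε > 0 there exists n₀ such that the following holds for all n ≥ n₀: for every tree T with n vertices and every finite abelian group Γ with |Γ| ≥ (1 + ε)·n, there exists an injective map f : V(T) → Γ such that the map assigning to each edge {x,y} of T the element f(x) + f(y) is injective on the edge set of T. -/

import Mathlib

/-- The element of `Γ` assigned to an edge `{x, y}` by a labeling `f`: the sum
`f x + f y`. -/
def labelSum {V Γ : Type*} [AddCommMonoid Γ] (f : V → Γ) : Sym2 V → Γ :=
  Sym2.lift ⟨fun x y => f x + f y, fun x y => add_comm (f x) (f y)⟩

set_option linter.unusedSectionVars false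

section Helpers

open Finset

/-- The cross-correlation of two real functions on a finite abelian group. -/
noncomputable def corr {Γ : Type} [AddCommGroup Γ] [Fintype Γ] (f g : Γ → ℝ) (d : Γ) : ℝ :=
  ∑ s, f s * g (s + d)

/-- The additive energy of a real function on a finite abelian group. -/
noncomputable def energy {Γ : Type} [AddCommGroup Γ] [Fintype Γ] (g : Γ → ℝ) : ℝ :=
  ∑ d, corr g g d ^ 2

/-- A quarter of the gradient of `energy` at `g`. -/
noncomputable def energyGrad {Γ : Type} [AddCommGroup Γ] [Fintype Γ] (g : Γ → ℝ) : Γ → ℝ :=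
  corr (corr g g) g

section Energy

variable {Γ : Type} [AddCommGroup Γ] [Fintype Γ]

lemma sum_add_right_eq (f : Γ → ℝ) (a : Γ) : ∑ s, f (s + a) = ∑ s, f s :=
  Equiv.sum_comp (Equiv.addRight a) f

lemma sum_add_left_eq (f : Γ → ℝ) (a : Γ) : ∑ s, f (a + s) = ∑ s, f s :=
  Equiv.sum_comp (Equiv.addLeft a) f

lemma sum_neg_eq (f : Γ → ℝ) : ∑ s, f (-s) = ∑ s, f s :=
  Equiv.sum_comp (Equiv.neg Γ) f

lemma corr_neg (f g : Γ → ℝ) (d : Γ) : corr f g (-d) = corr g f d := by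
  unfold corr
  rw [← sum_add_right_eq (fun s => f s * g (s + -d)) d]
  exact sum_congr rfl fun s _ => by rw [add_neg_cancel_right, mul_comm]

lemma corr_add_add (f g h k : Γ → ℝ) (d : Γ) :
    corr (f + g) (h + k) d = corr f h d + corr f k d + corr g h d + corr g k d := by
  simp only [corr, Pi.add_apply, ← sum_add_distrib]
  exact sum_congr rfl fun s _ => by ring

lemma sum_corr (f g : Γ → ℝ) : ∑ d, corr f g d = (∑ s, f s) * ∑ s, g s := by
  simp only [corr]
  rw [sum_comm, sum_mul]
  exact sum_congr rfl fun s _ => by rw [← mul_sum, sum_add_left_eq]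

lemma sum_corr_mul_corr (f g : Γ → ℝ) :
    ∑ d, corr f f d * corr g g d = ∑ d, corr f g d ^ 2 := by
  have h1 : ∀ d, corr f f d * corr g g d =
      ∑ s, ∑ e, f s * f (s + d) * (g (s + e) * g (s + e + d)) := by
    intro d
    simp only [corr]
    rw [sum_mul]
    refine sum_congr rfl fun s _ => ?_
    rw [← mul_sum, sum_add_left_eq (fun t => g t * g (t + d)) s]
  have h2 : ∀ e, corr f g e ^ 2 =
      ∑ s, ∑ d, f s * g (s + e) * (f (s + d) * g (s + d + e)) := by
    intro d
    rw [sq]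
    simp only [corr]
    rw [sum_mul]
    refine sum_congr rfl fun s _ => ?_
    rw [← mul_sum, sum_add_left_eq (fun t => f t * g (t + d)) s]
  simp only [h1, h2]
  rw [sum_comm]
  conv_rhs => rw [sum_comm]
  refine sum_congr rfl fun s _ => ?_
  rw [sum_comm]
  refine sum_congr rfl fun e _ => sum_congr rfl fun d _ => ?_
  rw [show s + d + e = s + e + d by abel]
  ring

lemma energy_nonneg (g : Γ → ℝ) : 0 ≤ energy g := sum_nonneg fun _ _ => sq_nonneg _

lemma sum_sq_corr_sq_le (f g : Γ → ℝ) :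
    (∑ d, corr f g d ^ 2) ^ 2 ≤ energy f * energy g := by
  rw [← sum_corr_mul_corr]
  exact sum_mul_sq_le_sq_mul_sq _ _ _

lemma sum_mul_energyGrad (g h : Γ → ℝ) :
    ∑ s, h s * energyGrad g s = ∑ d, corr g g d * corr h g d := by
  simp only [energyGrad]
  rw [show (∑ s, h s * corr (corr g g) g s) = ∑ s, ∑ d, h s * (corr g g d * g (d + s)) from
    sum_congr rfl fun s _ => by rw [corr, mul_sum]]
  rw [sum_comm]
  refine sum_congr rfl fun d _ => ?_
  rw [corr, corr, mul_sum]
  exact sum_congr rfl fun s _ => by rw [add_comm d s]; ring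

lemma sum_self_mul_energyGrad (g : Γ → ℝ) : ∑ s, g s * energyGrad g s = energy g := by
  rw [sum_mul_energyGrad, energy]
  exact sum_congr rfl fun d _ => (sq _).symm

lemma sum_corr_self_mul_corr (g h : Γ → ℝ) :
    ∑ d, corr g g d * corr g h d = ∑ d, corr g g d * corr h g d := by
  rw [← sum_neg_eq]
  exact sum_congr rfl fun d _ => by rw [corr_neg, corr_neg]

lemma sum_energyGrad (g : Γ → ℝ) (hg : ∑ s, g s = 0) : ∑ s, energyGrad g s = 0 := by
  rw [energyGrad, sum_corr, hg, mul_zero]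

lemma sum_energyGrad_sq_sq_le (g : Γ → ℝ) :
    (∑ s, energyGrad g s ^ 2) ^ 2 ≤ Fintype.card Γ * energy g ^ 3 := by
  have h1 : ∑ s, energyGrad g s ^ 2 ≤ energy g * ∑ d, |corr g g d| := by
    rw [energyGrad, ← sum_corr_mul_corr, mul_sum]
    refine sum_le_sum fun d _ => ?_
    have h2 : |corr (corr g g) (corr g g) d| ≤ energy g := by
      rw [← abs_of_nonneg (energy_nonneg g)]
      apply sq_le_sq.1
      calc corr (corr g g) (corr g g) d ^ 2
          ≤ (∑ s, corr g g s ^ 2) * ∑ s, corr g g (s + d) ^ 2 := sum_mul_sq_le_sq_mul_sq _ _ _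
        _ = energy g ^ 2 := by
            rw [sum_add_right_eq (fun s => corr g g s ^ 2) d, energy, sq]
    calc _ ≤ |corr (corr g g) (corr g g) d * corr g g d| := le_abs_self _
      _ = |corr (corr g g) (corr g g) d| * |corr g g d| := abs_mul _ _
      _ ≤ _ := by gcongr
  have h3 : (∑ d, |corr g g d|) ^ 2 ≤ Fintype.card Γ * energy g := by
    have := sq_sum_le_card_mul_sum_sq (s := (univ : Finset Γ)) (f := fun d => |corr g g d|)
    simpa [energy, card_univ] using this
  calc (∑ s, energyGrad g s ^ 2) ^ 2 ≤ (energy g * ∑ d, |corr g g d|) ^ 2 := by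
        gcongr
    _ = energy g ^ 2 * (∑ d, |corr g g d|) ^ 2 := by ring
    _ ≤ energy g ^ 2 * (Fintype.card Γ * energy g) := by gcongr
    _ = _ := by ring

lemma abs_corr_le {f g : Γ → ℝ} {b : ℝ} (hg : ∀ s, |g s| ≤ b) (d : Γ) :
    |corr f g d| ≤ (∑ s, |f s|) * b := by
  rw [corr, sum_mul]
  refine (abs_sum_le_sum_abs _ _).trans (sum_le_sum fun s _ => ?_)
  rw [abs_mul]
  gcongr
  exact hg _

lemma abs_le_sum_abs (h : Γ → ℝ) (s : Γ) : |h s| ≤ ∑ t, |h t| :=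
  single_le_sum (f := fun t => |h t|) (fun _ _ => abs_nonneg _) (mem_univ s)

lemma sum_abs_corr_le (f g : Γ → ℝ) : ∑ d, |corr f g d| ≤ (∑ s, |f s|) * ∑ s, |g s| := by
  rw [← sum_corr (fun s => |f s|) (fun s => |g s|)]
  refine sum_le_sum fun d _ => ?_
  refine (abs_sum_le_sum_abs _ _).trans (sum_le_sum fun s _ => ?_)
  rw [abs_mul]

/-- A small perturbation changes the energy by at most its linear part plus `O(|Γ|)`. -/
lemma energy_add_le_linear {g h : Γ → ℝ} (hg : ∀ s, |g s| ≤ 1) (hh : ∑ s, |h s| ≤ 2) :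
    energy (g + h) ≤ energy g + 4 * ∑ s, h s * energyGrad g s + 72 * Fintype.card Γ := by
  have hh0 : 0 ≤ ∑ s, |h s| := sum_nonneg fun _ _ => abs_nonneg _
  have hL1 : ∀ d, |corr h g d| ≤ 2 := fun d => (abs_corr_le hg d).trans (by linarith)
  have hL2 : ∀ d, |corr g h d| ≤ 2 := fun d => by
    rw [← neg_neg d, corr_neg]; exact hL1 _
  have hQ : ∀ d, |corr h h d| ≤ 4 := fun d =>
    (abs_corr_le (abs_le_sum_abs h) d).trans (by nlinarith)
  have hQs : ∑ d, |corr h h d| ≤ 4 := (sum_abs_corr_le h h).trans (by nlinarith)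
  have hr : ∀ d, |corr g g d| ≤ Fintype.card Γ := fun d => by
    refine (abs_corr_le hg d).trans ?_
    rw [mul_one]
    calc ∑ s, |g s| ≤ ∑ _s : Γ, (1 : ℝ) := sum_le_sum fun s _ => hg s
      _ = _ := by simp
  have key : ∀ d, corr (g + h) (g + h) d ^ 2 ≤ corr g g d ^ 2 +
      2 * (corr g g d * corr g h d) + 2 * (corr g g d * corr h g d) +
      2 * Fintype.card Γ * |corr h h d| + 64 := by
    intro d
    rw [corr_add_add]
    have h1 : corr g g d * corr h h d ≤ Fintype.card Γ * |corr h h d| := by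
      refine (le_abs_self _).trans ?_
      rw [abs_mul]
      gcongr
      exact hr d
    have h2 : (corr g h d + corr h g d + corr h h d) ^ 2 ≤ 64 := by
      have : |corr g h d + corr h g d + corr h h d| ≤ 8 := by
        refine (abs_add_three _ _ _).trans ?_
        linarith [hL1 d, hL2 d, hQ d]
      have := sq_le_sq' (abs_le.1 this).1 (abs_le.1 this).2
      linarith
    nlinarith
  have hsum := sum_le_sum fun d (_ : d ∈ (univ : Finset Γ)) => key d
  simp only [sum_add_distrib, ← mul_sum] at hsum
  rw [sum_corr_self_mul_corr, ← sum_mul_energyGrad] at hsum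
  simp only [sum_const, card_univ, nsmul_eq_mul] at hsum
  have hc : (0 : ℝ) ≤ Fintype.card Γ := Nat.cast_nonneg _
  have := mul_le_mul_of_nonneg_left hQs (by positivity : (0 : ℝ) ≤ 2 * Fintype.card Γ)
  simp only [energy] at *
  linarith

lemma energy_add_le (f g : Γ → ℝ) : energy (f + g) ≤ 8 * (energy f + energy g) := by
  have h1 : energy (f + g) ≤ ∑ d, 4 * (corr f f d ^ 2 + corr f g d ^ 2 + corr g f d ^ 2 +
      corr g g d ^ 2) := by
    refine sum_le_sum fun d _ => ?_
    rw [corr_add_add]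
    nlinarith [sq_nonneg (corr f f d - corr f g d), sq_nonneg (corr f f d - corr g f d),
      sq_nonneg (corr f f d - corr g g d), sq_nonneg (corr f g d - corr g f d),
      sq_nonneg (corr f g d - corr g g d), sq_nonneg (corr g f d - corr g g d)]
  have cross : ∀ f g : Γ → ℝ, 2 * ∑ d, corr f g d ^ 2 ≤ energy f + energy g := by
    intro f g
    rw [← sum_corr_mul_corr, energy, energy, mul_sum, ← sum_add_distrib]
    exact sum_le_sum fun d _ => by nlinarith [sq_nonneg (corr f f d - corr g g d)]
  have h2 := cross f g
  have h3 := cross g f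
  rw [← mul_sum] at h1
  simp only [sum_add_distrib] at h1
  change _ ≤ 4 * (energy f + _ + _ + energy g) at h1
  linarith

lemma energy_const_mul (c : ℝ) (g : Γ → ℝ) : energy (fun s => c * g s) = c ^ 4 * energy g := by
  simp only [energy, mul_sum]
  refine sum_congr rfl fun d _ => ?_
  have : corr (fun s => c * g s) (fun s => c * g s) d = c ^ 2 * corr g g d := by
    rw [corr, corr, mul_sum]
    exact sum_congr rfl fun s _ => by ring
  rw [this]
  ring

lemma energy_const_mul_le {c : ℝ} (hc : |c| ≤ 1) (g : Γ → ℝ) :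
    energy (fun s => c * g s) ≤ energy g := by
  rw [energy_const_mul]
  have : c ^ 4 ≤ 1 := by
    rw [← Even.pow_abs (by decide : Even 4)]
    exact pow_le_one₀ (abs_nonneg c) hc
  nlinarith [energy_nonneg g]

lemma sum_pow_four_le (g : Γ → ℝ) : (∑ s, g s) ^ 4 ≤ Fintype.card Γ * energy g := by
  have h := sq_sum_le_card_mul_sum_sq (s := (univ : Finset Γ)) (f := corr g g)
  rw [sum_corr, card_univ] at h
  calc _ = ((∑ s, g s) * ∑ s, g s) ^ 2 := by ring
    _ ≤ _ := h

lemma energy_add_const_of_sum_eq_zero (g : Γ → ℝ) (hg : ∑ s, g s = 0) (c : ℝ) :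
    energy g ≤ energy (fun s => g s + c) := by
  have h : ∀ d, corr (fun s => g s + c) (fun s => g s + c) d =
      corr g g d + Fintype.card Γ * c ^ 2 := by
    intro d
    have : ∀ s, (g s + c) * (g (s + d) + c) = g s * g (s + d) + c * g s + c * g (s + d) + c ^ 2 :=
      fun s => by ring
    simp only [corr, this, sum_add_distrib, ← mul_sum, sum_add_right_eq, hg]
    simp
  have h0 : ∑ d, corr g g d = 0 := by rw [sum_corr, hg, mul_zero]
  have : ∀ d, corr (fun s => g s + c) (fun s => g s + c) d ^ 2 = corr g g d ^ 2 +
      2 * (Fintype.card Γ * c ^ 2) * corr g g d + (Fintype.card Γ * c ^ 2) ^ 2 := by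
    intro d; rw [h]; ring
  simp only [energy, this, sum_add_distrib, ← mul_sum, h0]
  have : 0 ≤ ∑ _d : Γ, ((Fintype.card Γ : ℝ) * c ^ 2) ^ 2 := sum_nonneg fun _ _ => sq_nonneg _
  linarith

lemma energy_le_of_bounded {ξ : Γ → ℝ} {Δ : ℝ} (h0 : ∀ x, 0 ≤ ξ x) (h1 : ∀ x, ξ x ≤ Δ)
    (hs : ∑ x, ξ x ≤ Fintype.card Γ) : energy ξ ≤ Δ * Fintype.card Γ ^ 3 := by
  have hs0 : 0 ≤ ∑ x, ξ x := sum_nonneg fun x _ => h0 x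
  have hΔ : 0 ≤ Δ := (h0 0).trans (h1 0)
  have hc0 : ∀ d, 0 ≤ corr ξ ξ d := fun d => sum_nonneg fun s _ => mul_nonneg (h0 _) (h0 _)
  have hc : ∀ d, corr ξ ξ d ≤ Δ * Fintype.card Γ := fun d => by
    calc corr ξ ξ d ≤ ∑ s, ξ s * Δ := sum_le_sum fun s _ => by gcongr; exacts [h0 s, h1 _]
      _ = (∑ s, ξ s) * Δ := by rw [sum_mul]
      _ ≤ Fintype.card Γ * Δ := by gcongr
      _ = _ := mul_comm _ _
  calc energy ξ ≤ ∑ d, (Δ * Fintype.card Γ) * corr ξ ξ d :=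
        sum_le_sum fun d _ => by rw [sq]; gcongr; exacts [hc0 d, hc d]
    _ = (Δ * Fintype.card Γ) * ((∑ x, ξ x) * ∑ x, ξ x) := by rw [← mul_sum, sum_corr]
    _ ≤ (Δ * Fintype.card Γ) * (Fintype.card Γ * Fintype.card Γ) := by gcongr
    _ = _ := by ring

end Energy

/-- The real indicator function of a finite set. -/
noncomputable def ind {Γ : Type} [DecidableEq Γ] (U : Finset Γ) (s : Γ) : ℝ :=
  if s ∈ U then 1 else 0

/-- The indicator function of a set minus its mean. -/
noncomputable def bal {Γ : Type} [Fintype Γ] [DecidableEq Γ] (U : Finset Γ) (s : Γ) : ℝ :=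
  ind U s - #U / Fintype.card Γ

section Removal

variable {Γ : Type} [AddCommGroup Γ] [Fintype Γ] [DecidableEq Γ]

lemma ind_nonneg (U : Finset Γ) (s : Γ) : 0 ≤ ind U s := by unfold ind; split_ifs <;> norm_num

lemma ind_le_one (U : Finset Γ) (s : Γ) : ind U s ≤ 1 := by unfold ind; split_ifs <;> norm_num

lemma abs_ind_le_one (U : Finset Γ) (s : Γ) : |ind U s| ≤ 1 := by
  rw [abs_of_nonneg (ind_nonneg U s)]; exact ind_le_one U s

lemma sum_ind (U : Finset Γ) : ∑ s, ind U s = #U := by simp [ind]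

lemma sum_bal (U : Finset Γ) : ∑ s, bal U s = 0 := by
  have : (Fintype.card Γ : ℝ) ≠ 0 := by exact_mod_cast Fintype.card_ne_zero
  simp only [bal, sum_sub_distrib, sum_ind, sum_const, card_univ, nsmul_eq_mul]
  field_simp
  ring

lemma abs_bal_le_one (U : Finset Γ) (s : Γ) : |bal U s| ≤ 1 := by
  have h1 : (#U : ℝ) / Fintype.card Γ ≤ 1 :=
    div_le_one_of_le₀ (by exact_mod_cast card_le_univ U) (Nat.cast_nonneg _)
  have h2 : (0 : ℝ) ≤ #U / Fintype.card Γ := by positivity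
  rw [abs_le, bal]
  constructor <;> linarith [ind_nonneg U s, ind_le_one U s]

lemma corr_ind_eq (ξ : Γ → ℝ) (S : Finset Γ) (u : Γ) :
    corr ξ (ind S) u = corr ξ (bal S) u + #S / Fintype.card Γ * ∑ x, ξ x := by
  simp only [corr, bal, mul_sub, sum_sub_distrib, ← sum_mul]
  ring

lemma abs_le_of_pow_four_le {x y : ℝ} (h : x ^ 4 ≤ y ^ 4) (hy : 0 ≤ y) : |x| ≤ y :=
  (pow_le_pow_iff_left₀ (abs_nonneg x) hy (by norm_num : 4 ≠ 0)).1
    (by rwa [Even.pow_abs (by decide)])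

lemma sum_mul_corr_pow_four_le (ξ f g : Γ → ℝ) (hf : ∀ u, |f u| ≤ 1) :
    (∑ u, f u * corr ξ g u) ^ 4 ≤ Fintype.card Γ ^ 2 * (energy ξ * energy g) := by
  have h1 : (∑ u, f u * corr ξ g u) ^ 2 ≤ Fintype.card Γ * ∑ u, corr ξ g u ^ 2 := by
    refine (sum_mul_sq_le_sq_mul_sq _ _ _).trans ?_
    refine mul_le_mul_of_nonneg_right ?_ (sum_nonneg fun _ _ => sq_nonneg _)
    calc ∑ u, f u ^ 2 ≤ ∑ _u : Γ, (1 : ℝ) :=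
          sum_le_sum fun u _ => (sq_le_one_iff_abs_le_one _).2 (hf u)
      _ = _ := by simp
  calc (∑ u, f u * corr ξ g u) ^ 4 = ((∑ u, f u * corr ξ g u) ^ 2) ^ 2 := by ring
    _ ≤ (Fintype.card Γ * ∑ u, corr ξ g u ^ 2) ^ 2 := by gcongr
    _ = Fintype.card Γ ^ 2 * (∑ u, corr ξ g u ^ 2) ^ 2 := by ring
    _ ≤ _ := by gcongr; exact sum_sq_corr_sq_le _ _

/-- Counting lemma: a set with small balanced energy is seen uniformly by translates. -/
lemma abs_sum_ind_mul_corr_bal_le {ξ : Γ → ℝ} {Δ δ : ℝ} (h0 : ∀ x, 0 ≤ ξ x) (h1 : ∀ x, ξ x ≤ Δ)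
    (hs : ∑ x, ξ x ≤ Fintype.card Γ) (U S : Finset Γ) (hδ : 0 ≤ δ) {η : ℝ}
    (hS : energy (bal S) ≤ η * Fintype.card Γ ^ 3) (hΔ : Δ * η ≤ δ ^ 4) :
    |∑ u, ind U u * corr ξ (bal S) u| ≤ δ * Fintype.card Γ ^ 2 := by
  have h := sum_mul_corr_pow_four_le ξ (ind U) (bal S) (abs_ind_le_one U)
  have h2 := energy_le_of_bounded h0 h1 hs
  refine abs_le_of_pow_four_le ?_ (by positivity)
  have hΔ0 : 0 ≤ Δ := (h0 0).trans (h1 0)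
  calc _ ≤ _ := h
    _ ≤ (Fintype.card Γ : ℝ) ^ 2 * (Δ * Fintype.card Γ ^ 3 * (η * Fintype.card Γ ^ 3)) := by
        gcongr
        exact energy_nonneg _
    _ = (Δ * η) * (Fintype.card Γ : ℝ) ^ 8 := by ring
    _ ≤ δ ^ 4 * (Fintype.card Γ : ℝ) ^ 8 := by gcongr
    _ = _ := by ring

lemma energy_bal_erase_le (U : Finset Γ) {u : Γ} (hu : u ∈ U) :
    energy (bal (U.erase u)) ≤
      energy (bal U) - 4 * energyGrad (bal U) u + 72 * Fintype.card Γ := by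
  have hm : (0 : ℝ) < Fintype.card Γ := by exact_mod_cast Fintype.card_pos
  set h : Γ → ℝ := fun s => (if s = u then -1 else 0) + 1 / Fintype.card Γ with hh
  have e : bal (U.erase u) = bal U + h := by
    funext s
    have : (#(U.erase u) : ℝ) = #U - 1 := by
      rw [card_erase_of_mem hu, Nat.cast_sub (card_pos.2 ⟨u, hu⟩)]; simp
    simp only [bal, ind, Pi.add_apply, hh, this, mem_erase]
    by_cases hs : s = u
    · subst hs; simp [hu]; ring
    · simp [hs]; ring
  have h1 : ∑ s, |h s| ≤ 2 := by
    calc ∑ s, |h s| ≤ ∑ s, ((if s = u then 1 else 0) + 1 / (Fintype.card Γ : ℝ)) := by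
          refine sum_le_sum fun s _ => (abs_add_le _ _).trans ?_
          rw [abs_of_pos (by positivity : 0 < 1 / (Fintype.card Γ : ℝ))]
          split_ifs <;> simp
      _ = 2 := by
          rw [sum_add_distrib]
          simp
          norm_num
  have h2 : ∑ s, h s * energyGrad (bal U) s = - energyGrad (bal U) u := by
    simp only [hh, add_mul, sum_add_distrib, ← mul_sum, sum_energyGrad _ (sum_bal U)]
    simp
  rw [e]
  refine (energy_add_le_linear (abs_bal_le_one U) h1).trans ?_
  rw [h2]
  linarith

lemma neg_le_sum_ind_mul_corr_mul_energyGrad {ξ : Γ → ℝ} {Δ Φ : ℝ} (h0 : ∀ x, 0 ≤ ξ x)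
    (h1 : ∀ x, ξ x ≤ Δ) (hΔ : 1 ≤ Δ) (hs : ∑ x, ξ x ≤ Fintype.card Γ) (U S : Finset Γ)
    (hU : energy (bal U) ≤ Φ) (hS : energy (bal S) ≤ Φ) :
    -(Δ * Fintype.card Γ * Φ) ≤
      ∑ u, ind U u * corr ξ (ind S) u * energyGrad (bal U) u := by
  have hm : (0 : ℝ) < Fintype.card Γ := by exact_mod_cast Fintype.card_pos
  have hE := energy_nonneg (bal U)
  have hE' := energy_nonneg (bal S)
  have hΦ : 0 ≤ Φ := hE.trans hU
  have e1 : ∑ u, ind U u * energyGrad (bal U) u = energy (bal U) := by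
    rw [← sum_self_mul_energyGrad]
    simp only [bal, sub_mul, sum_sub_distrib, ← mul_sum]
    have := sum_energyGrad _ (sum_bal U)
    simp [this]
  have e2 : ∑ u, ind U u * corr ξ (ind S) u * energyGrad (bal U) u =
      ∑ u, ind U u * corr ξ (bal S) u * energyGrad (bal U) u +
        #S / Fintype.card Γ * (∑ x, ξ x) * energy (bal U) := by
    rw [← e1, mul_sum, ← sum_add_distrib]
    exact sum_congr rfl fun u _ => by rw [corr_ind_eq]; ring
  have h3 : 0 ≤ #S / Fintype.card Γ * (∑ x, ξ x) * energy (bal U) :=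
    mul_nonneg (mul_nonneg (by positivity) (sum_nonneg fun x _ => h0 x)) hE
  have h4 : |∑ u, ind U u * corr ξ (bal S) u * energyGrad (bal U) u| ≤
      Δ * Fintype.card Γ * Φ := by
    refine abs_le_of_pow_four_le ?_ (by positivity)
    have h5 : (∑ u, ind U u * corr ξ (bal S) u * energyGrad (bal U) u) ^ 2 ≤
        (∑ u, corr ξ (bal S) u ^ 2) * ∑ u, energyGrad (bal U) u ^ 2 := by
      refine (sum_mul_sq_le_sq_mul_sq _ _ _).trans ?_
      refine mul_le_mul_of_nonneg_right (sum_le_sum fun u _ => ?_)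
        (sum_nonneg fun _ _ => sq_nonneg _)
      rw [mul_pow]
      have := (sq_le_one_iff_abs_le_one _).2 (abs_ind_le_one U u)
      nlinarith [sq_nonneg (corr ξ (bal S) u)]
    have hξ := energy_le_of_bounded h0 h1 hs
    have hξ0 := energy_nonneg ξ
    calc _ = ((∑ u, ind U u * corr ξ (bal S) u * energyGrad (bal U) u) ^ 2) ^ 2 := by ring
      _ ≤ ((∑ u, corr ξ (bal S) u ^ 2) * ∑ u, energyGrad (bal U) u ^ 2) ^ 2 := by gcongr
      _ = (∑ u, corr ξ (bal S) u ^ 2) ^ 2 * (∑ u, energyGrad (bal U) u ^ 2) ^ 2 := by ring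
      _ ≤ (energy ξ * energy (bal S)) * (Fintype.card Γ * energy (bal U) ^ 3) := by
          gcongr
          · exact sum_sq_corr_sq_le _ _
          · exact sum_energyGrad_sq_sq_le _
      _ ≤ ((Δ * Fintype.card Γ ^ 3) * Φ) * (Fintype.card Γ * Φ ^ 3) := by gcongr
      _ = Δ * (Fintype.card Γ * Φ) ^ 4 := by ring
      _ ≤ Δ ^ 4 * (Fintype.card Γ * Φ) ^ 4 := by
          gcongr
          exact le_self_pow₀ hΔ (by norm_num)
      _ = _ := by ring
  linarith [(abs_le.1 h4).1]

/-- One can remove an element `u` from `U` and an element `x + u` from `S`, with `x` in the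
support of `ξ`, so that the total energy grows by at most a factor `1 + O(1 / |Γ|)`. -/
lemma exists_erase_energy_le {ξ : Γ → ℝ} {Δ ρ θ η p C Φ : ℝ} (h0 : ∀ x, 0 ≤ ξ x)
    (h1 : ∀ x, ξ x ≤ Δ) (hΔ : 1 ≤ Δ) (hs : ∑ x, ξ x ≤ Fintype.card Γ)
    (hsθ : θ * Fintype.card Γ ≤ ∑ x, ξ x) (U S : Finset Γ) (hp : 0 < p)
    (hρ : 0 ≤ ρ) (hθ : 0 ≤ θ)
    (hpp : 2 * p = ρ ^ 2 * θ) (hΔη : Δ * η ≤ p ^ 4) (hC : C = 8 * Δ / p)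
    (hU : ρ * Fintype.card Γ ≤ #U) (hS : ρ * Fintype.card Γ ≤ #S)
    (hΦ : energy (bal U) + energy (bal S) ≤ Φ) (hΦη : Φ ≤ η * Fintype.card Γ ^ 3) :
    ∃ x u, 0 < ξ x ∧ u ∈ U ∧ x + u ∈ S ∧
      energy (bal (U.erase u)) + energy (bal (S.erase (x + u))) ≤
        (1 + C / Fintype.card Γ) * Φ + 144 * Fintype.card Γ := by
  have hm : (0 : ℝ) < Fintype.card Γ := by exact_mod_cast Fintype.card_pos
  have hEU := energy_nonneg (bal U)
  have hES := energy_nonneg (bal S)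
  have hΦ0 : 0 ≤ Φ := by linarith
  set m : ℝ := (Fintype.card Γ : ℝ) with hmdef
  set w : Γ × Γ → ℝ := fun z => ξ z.1 * ind U z.2 * ind S (z.1 + z.2) with hw
  have hw0 : ∀ z, 0 ≤ w z := fun z =>
    mul_nonneg (mul_nonneg (h0 _) (ind_nonneg _ _)) (ind_nonneg _ _)
  have hW : p * m ^ 2 ≤ ∑ z, w z := by
    have e : ∑ z, w z = ∑ u, ind U u * corr ξ (bal S) u + #U * #S / m * ∑ x, ξ x := by
      rw [Fintype.sum_prod_type, sum_comm]
      have : ∀ u, ∑ x, w (x, u) =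
          ind U u * corr ξ (bal S) u + ind U u * (#S / m * ∑ x, ξ x) := by
        intro u
        rw [← mul_add, ← corr_ind_eq, corr, mul_sum]
        exact sum_congr rfl fun x _ => by simp only [hw]; ring
      simp only [this, sum_add_distrib, ← sum_mul, sum_ind]
      ring
    have h2 := abs_sum_ind_mul_corr_bal_le h0 h1 hs U S hp.le (by linarith) hΔη
    have h3 : ρ ^ 2 * θ * m ^ 2 ≤ #U * #S / m * ∑ x, ξ x := by
      calc ρ ^ 2 * θ * m ^ 2 = (ρ * m) * (ρ * m) / m * (θ * m) := by field_simp
        _ ≤ _ := by gcongr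
    rw [e]
    have := (abs_le.1 h2).1
    rw [← hpp] at h3
    linarith
  have hWpos : 0 < ∑ z, w z := lt_of_lt_of_le (by positivity) hW
  have hA := neg_le_sum_ind_mul_corr_mul_energyGrad h0 h1 hΔ hs U S
    (by linarith : _ ≤ Φ) (by linarith)
  have hB := neg_le_sum_ind_mul_corr_mul_energyGrad (ξ := fun x => ξ (-x)) (fun x => h0 _)
    (fun x => h1 _) hΔ (by rwa [sum_neg_eq]) S U (by linarith : _ ≤ Φ) (by linarith)
  have hA' : ∑ u, ind U u * corr ξ (ind S) u * energyGrad (bal U) u =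
      ∑ z, w z * energyGrad (bal U) z.2 := by
    rw [Fintype.sum_prod_type, sum_comm]
    refine sum_congr rfl fun u _ => ?_
    rw [corr, mul_sum, sum_mul]
    exact sum_congr rfl fun x _ => by simp only [hw]; ring
  have hB' : ∑ s, ind S s * corr (fun x => ξ (-x)) (ind U) s * energyGrad (bal S) s =
      ∑ z, w z * energyGrad (bal S) (z.1 + z.2) := by
    rw [Fintype.sum_prod_type]
    have : ∀ x, ∑ u, w (x, u) * energyGrad (bal S) (x + u) =
        ∑ s, ξ x * ind U (-x + s) * ind S s * energyGrad (bal S) s := by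
      intro x
      rw [← sum_add_left_eq (fun s => ξ x * ind U (-x + s) * ind S s * _) x]
      refine sum_congr rfl fun u _ => ?_
      simp only [hw, neg_add_cancel_left]
    simp only [this]
    rw [sum_comm]
    refine sum_congr rfl fun s _ => ?_
    rw [← sum_mul, corr, mul_sum, ← sum_neg_eq (fun x => ξ x * ind U (-x + s) * ind S s)]
    congr 1
    exact sum_congr rfl fun x _ => by simp only [neg_neg]; ring
  rw [hA'] at hA
  rw [hB'] at hB
  obtain ⟨z, hz, hG⟩ : ∃ z, 0 < w z ∧ -(2 * Δ * Φ / (p * m)) ≤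
      energyGrad (bal U) z.2 + energyGrad (bal S) (z.1 + z.2) := by
    by_contra! hcon
    have h4 : ∑ z, w z * (energyGrad (bal U) z.2 + energyGrad (bal S) (z.1 + z.2)) <
        ∑ z, w z * -(2 * Δ * Φ / (p * m)) := by
      refine sum_lt_sum (fun z _ => ?_) ?_
      · rcases (hw0 z).eq_or_lt with h | h
        · simp [← h]
        · exact mul_le_mul_of_nonneg_left (hcon z h).le h.le
      · obtain ⟨z, hz, hz'⟩ := exists_lt_of_sum_lt (s := (univ : Finset (Γ × Γ)))
          (f := fun _ => (0 : ℝ)) (g := w) (by simpa using hWpos)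
        exact ⟨z, mem_univ _, mul_lt_mul_of_pos_left (hcon z hz') hz'⟩
    simp only [mul_add, sum_add_distrib] at h4
    rw [← sum_mul] at h4
    have h5 : 2 * Δ * m * Φ ≤ (∑ z, w z) * (2 * Δ * Φ / (p * m)) := by
      calc 2 * Δ * m * Φ = (p * m ^ 2) * (2 * Δ * Φ / (p * m)) := by field_simp
        _ ≤ _ := by gcongr
    linarith
  have hzU : z.2 ∈ U := by
    by_contra h; simp [hw, ind, h] at hz
  have hzS : z.1 + z.2 ∈ S := by
    by_contra h; simp [hw, ind, h] at hz
  refine ⟨z.1, z.2, ?_, hzU, hzS, ?_⟩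
  · refine lt_of_le_of_ne (h0 _) fun h => ?_
    simp [hw, ← h] at hz
  · have a1 := energy_bal_erase_le U hzU
    have a2 := energy_bal_erase_le S hzS
    have : C / m * Φ = 4 * (2 * Δ * Φ / (p * m)) := by rw [hC]; field_simp; ring
    rw [add_mul, this]
    linarith

/-- The bound for the total energy after `k` removals. -/
noncomputable def energyBound (C m Φ : ℝ) (k : ℕ) : ℝ := (1 + C / m) ^ k * (Φ + 144 * m * k)

lemma energyBound_succ {C m Φ : ℝ} (hC : 0 ≤ C) (hm : 0 ≤ m) (k : ℕ) :
    (1 + C / m) * energyBound C m Φ k + 144 * m ≤ energyBound C m Φ (k + 1) := by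
  have h : (1 : ℝ) ≤ (1 + C / m) ^ (k + 1) :=
    one_le_pow₀ (by have : 0 ≤ C / m := by positivity
                    linarith)
  unfold energyBound
  push_cast
  have : (1 + C / m) ^ (k + 1) * (Φ + 144 * m * (k + 1)) =
    (1 + C / m) * ((1 + C / m) ^ k * (Φ + 144 * m * k)) + (1 + C / m) ^ (k + 1) * (144 * m) := by
    ring
  rw [this]
  nlinarith

lemma energyBound_mono {C m Φ : ℝ} (hC : 0 ≤ C) (hm : 0 ≤ m) (hΦ : 0 ≤ Φ) :
    Monotone (energyBound C m Φ) := by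
  refine monotone_nat_of_le_succ fun k => le_trans ?_ (energyBound_succ hC hm k)
  have h1 : 0 ≤ C / m := by positivity
  have h2 : 0 ≤ energyBound C m Φ k := by unfold energyBound; positivity
  nlinarith [mul_nonneg h1 h2]

/-- Place almost all of the vertices in `I`, where the parent of `i` has label `x i`, using labels
in `U` and edge sums in `S`, while keeping `U` and `S` pseudorandom. -/
lemma exists_layer {V : Type} [DecidableEq V] {Δ ρ θ η p C Φ₀ : ℝ} (hΔ : 1 ≤ Δ) (hp : 0 < p)
    (hρ : 0 ≤ ρ) (hθ : 0 ≤ θ) (hpp : 2 * p = ρ ^ 2 * θ)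
    (hΔη : Δ * η ≤ p ^ 4) (hC : C = 8 * Δ / p) (hΦ₀ : 0 ≤ Φ₀) {K : ℕ}
    (hK : energyBound C (Fintype.card Γ) Φ₀ K ≤ η * Fintype.card Γ ^ 3) (x : V → Γ) (n : ℕ) :
    ∀ (I : Finset V) (U S : Finset Γ) (k : ℕ), #I = n →
      (∀ y, (#{i ∈ I | x i = y} : ℝ) ≤ Δ) → (#I : ℝ) ≤ Fintype.card Γ →
      ρ * Fintype.card Γ + #I ≤ #U → ρ * Fintype.card Γ + #I ≤ #S → k + #I ≤ K →
      energy (bal U) + energy (bal S) ≤ energyBound C (Fintype.card Γ) Φ₀ k →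
      ∃ I' ⊆ I, (#(I \ I') : ℝ) ≤ θ * Fintype.card Γ ∧ ∃ w : V → Γ, Set.InjOn w I' ∧
        Set.InjOn (fun i => x i + w i) I' ∧ (∀ i ∈ I', w i ∈ U ∧ x i + w i ∈ S) ∧
        energy (bal (U \ I'.image w)) + energy (bal (S \ I'.image fun i => x i + w i)) ≤
          energyBound C (Fintype.card Γ) Φ₀ (k + #I) := by
  have hm : (0 : ℝ) < Fintype.card Γ := by exact_mod_cast Fintype.card_pos
  have hC0 : 0 ≤ C := by rw [hC]; positivity
  have hmono := energyBound_mono hC0 hm.le hΦ₀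
  induction n with
  | zero =>
    intro I U S k hI _ _ _ _ _ hE
    refine ⟨∅, empty_subset _, ?_, fun _ => 0, by simp, by simp, by simp, ?_⟩
    · simp [hI]; positivity
    · simpa [hI] using hE
  | succ n ih =>
    intro I U S k hI hmult hIm hU hS hk hE
    by_cases hsmall : (#I : ℝ) ≤ θ * Fintype.card Γ
    · refine ⟨∅, empty_subset _, by simpa using hsmall, fun _ => 0, by simp, by simp, by simp, ?_⟩
      simpa using hE.trans (hmono (Nat.le_add_right _ _))
    push Not at hsmall
    set ξ : Γ → ℝ := fun y => (#{i ∈ I | x i = y} : ℝ) with hξ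
    have hξs : ∑ y, ξ y = #I := by
      rw [card_eq_sum_card_fiberwise (f := x) (t := univ) (fun _ _ => by simp)]
      push_cast
      rfl
    have hI0 : (0 : ℝ) ≤ #I := Nat.cast_nonneg _
    obtain ⟨y, u, hy, hu, hyu, hE'⟩ := exists_erase_energy_le (ξ := ξ) (fun y => Nat.cast_nonneg _)
      hmult hΔ (by rwa [hξs]) (by rw [hξs]; exact hsmall.le) U S hp hρ hθ hpp hΔη hC
      (by linarith) (by linarith) hE ((hmono (by omega)).trans hK)
    obtain ⟨i, hi⟩ : ∃ i, i ∈ {i ∈ I | x i = y} := card_pos.1 (by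
      simp only [hξ] at hy; exact_mod_cast hy)
    obtain ⟨hiI, rfl⟩ := mem_filter.1 hi
    have hcard : #(I.erase i) = n := by rw [card_erase_of_mem hiI, hI]; rfl
    have hcardR : (#I : ℝ) = #(I.erase i) + 1 := by rw [hcard, hI]; push_cast; ring
    have hUe : (#(U.erase u) : ℝ) = #U - 1 := by
      rw [card_erase_of_mem hu, Nat.cast_sub (card_pos.2 ⟨u, hu⟩)]; simp
    have hSe : (#(S.erase (x i + u)) : ℝ) = #S - 1 := by
      rw [card_erase_of_mem hyu, Nat.cast_sub (card_pos.2 ⟨_, hyu⟩)]; simp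
    obtain ⟨I', hI'I, hI'c, w, hw1, hw2, hw3, hw4⟩ := ih (I.erase i) (U.erase u)
      (S.erase (x i + u)) (k + 1) hcard
      (fun y => le_trans (by
        exact_mod_cast card_le_card (filter_subset_filter _ (erase_subset _ _))) (hmult y))
      (by linarith) (by linarith) (by linarith) (by omega)
      (hE'.trans (energyBound_succ hC0 hm.le k))
    have hiI' : i ∉ I' := fun h => by simpa using hI'I h
    set w' := Function.update w i u with hw'
    have hwi : w' i = u := Function.update_self ..
    have hwj : ∀ j ∈ I', w' j = w j := fun j hj =>
      Function.update_of_ne (fun h : j = i => hiI' (h ▸ hj)) ..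
    have him1 : (insert i I').image w' = insert u (I'.image w) := by
      rw [image_insert, hwi, image_congr (fun j hj => hwj j hj)]
    have him2 : (insert i I').image (fun i => x i + w' i) =
        insert (x i + u) (I'.image fun i => x i + w i) := by
      rw [image_insert, hwi, image_congr (g := fun i => x i + w i)
        (fun j hj => by simp only [hwj j hj])]
    have heq : ∀ (A B : Finset Γ) (a : Γ), A \ insert a B = A.erase a \ B := by
      intro A B a; ext; simp; tauto
    refine ⟨insert i I', insert_subset hiI (hI'I.trans (erase_subset _ _)), ?_, w', ?_, ?_, ?_, ?_⟩
    · rwa [show I \ insert i I' = I.erase i \ I' by ext; simp; tauto]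
    · rw [coe_insert, Set.injOn_insert (by simpa using hiI')]
      refine ⟨hw1.congr fun j hj => (hwj j hj).symm, ?_⟩
      rintro ⟨j, hj, hj'⟩
      have := (hw3 j hj).1
      rw [← hwj j hj, hj', hwi] at this
      simp at this
    · rw [coe_insert, Set.injOn_insert (by simpa using hiI')]
      refine ⟨hw2.congr fun j hj => by simp only [hwj j hj], ?_⟩
      rintro ⟨j, hj, hj'⟩
      have := (hw3 j hj).2
      simp only [hwi] at hj'
      rw [← hwj j hj, hj'] at this
      simp at this
    · intro j hj
      rcases mem_insert.1 hj with rfl | hj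
      · rw [hwi]; exact ⟨hu, hyu⟩
      · rw [hwj j hj]
        exact ⟨mem_of_mem_erase (hw3 j hj).1, mem_of_mem_erase (hw3 j hj).2⟩
    · rw [him1, him2, heq, heq]
      refine hw4.trans (le_of_eq ?_)
      rw [hcard, hI]
      congr 1
      omega

end Removal

section Hall

variable {Γ : Type} [AddCommGroup Γ] [Fintype Γ] [DecidableEq Γ]

lemma eq_add_of_forall_ne {b : Γ → Γ} (hb : ∑ i, b i = 0) {a c : Equiv.Perm Γ} {j : Γ}
    (h : ∀ i, i ≠ j → c i = a i + b i) (i : Γ) : c i = a i + b i := by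
  by_cases hi : i = j
  · subst hi
    have h1 : ∑ i, c i = ∑ i, (a i + b i) := by
      rw [sum_add_distrib, hb, add_zero, Equiv.sum_comp a fun x => x, Equiv.sum_comp c fun x => x]
    rw [← add_sum_erase _ _ (mem_univ i), ← add_sum_erase (a := i) univ (fun i => a i + b i)
      (mem_univ i), sum_congr rfl fun j hj => h j (ne_of_mem_erase hj)] at h1
    exact add_right_cancel h1
  · exact h i hi

/-- The exchange process behind the theorem of Hall: `F` is the set of the places already repaired,
`p` is the place under repair and `j` is a place whose equation is disregarded. -/
lemma exists_perm_of_exchange {b : Γ → Γ} (hb : ∑ i, b i = 0) (a₀ : Γ → Γ)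
    (ha₀ : Function.Injective a₀) (K j : Γ) (n : ℕ) :
    ∀ (F : Finset Γ) (a c : Equiv.Perm Γ) (p : Γ), #(univ \ F) = n → p ∉ F → p ≠ j →
      (∀ i, i ≠ p → i ≠ j → c i = a i + b i) → (∀ i ∈ F, a i + b i + a₀ i = K) →
      (∀ i, i ∉ F → i ≠ j → a i = a₀ i) → j ∉ F → a p + a j + b p = K →
      ∃ a c : Equiv.Perm Γ, ∀ i, c i = a i + b i := by
  induction n with
  | zero =>
    intro F a c p hF hp
    rw [card_eq_zero] at hF
    exact absurd (mem_sdiff.2 ⟨mem_univ p, hp⟩) (by simp [hF])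
  | succ n ih =>
    intro F a c p hF hp hpj h1 h2 h3 hj hK
    set a' := (Equiv.swap p j).trans a with ha'
    have ap : a' p = a j := by simp [ha']
    have aj : a' j = a p := by simp [ha']
    have ai : ∀ i, i ≠ p → i ≠ j → a' i = a i := fun i hi hi' => by
      simp [ha', Equiv.swap_apply_of_ne_of_ne hi hi']
    set k := c.symm (a j + b p) with hk
    have ck : c k = a j + b p := by simp [hk]
    set c' := (Equiv.swap p k).trans c with hc'
    have cp : c' p = a' p + b p := by simp [hc', ap, ck]
    have ci : ∀ i, i ≠ p → i ≠ k → c' i = c i := fun i hi hi' => by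
      simp [hc', Equiv.swap_apply_of_ne_of_ne hi hi']
    have hgood : ∀ i, i ≠ k → i ≠ j → c' i = a' i + b i := by
      intro i hik hij
      by_cases hip : i = p
      · rw [hip, cp]
      · rw [ci i hip hik, ai i hip hij, h1 i hip hij]
    by_cases hkp : k = p
    · refine ⟨a', c', eq_add_of_forall_ne hb (j := j) fun i hi => ?_⟩
      by_cases hip : i = p
      · rw [hip, cp]
      · exact hgood i (by rwa [hkp]) hi
    by_cases hkj : k = j
    · exact ⟨a', c', eq_add_of_forall_ne hb (j := j) fun i hi => hgood i (by rwa [hkj]) hi⟩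
    have hck := h1 k hkp hkj
    have hkF : k ∉ F := by
      intro hkF
      have e1 := h2 k hkF
      rw [← hck, ck, ← hK, h3 p hp hpj] at e1
      apply hkp
      apply ha₀
      have : a j + b p + a₀ k = a j + b p + a₀ p := by rw [e1]; abel
      exact add_left_cancel this
    refine ih (insert p F) a' c' k ?_ (by simp [hkp, hkF]) hkj hgood ?_ ?_
      (by simp [hj, Ne.symm hpj]) ?_
    · have : #(univ \ insert p F) = #((univ \ F).erase p) := by
        congr 1; ext; simp
      rw [this, card_erase_of_mem (by simpa using hp), hF]; rfl
    · intro i hi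
      rcases mem_insert.1 hi with rfl | hi
      · rw [ap, ← hK, ← h3 i hp hpj]; abel
      · rw [ai i (fun h => hp (h ▸ hi)) (fun h => hj (h ▸ hi))]
        exact h2 i hi
    · intro i hi hij
      rw [mem_insert, not_or] at hi
      rw [ai i hi.1 hij, h3 i hi.2 hij]
    · rw [ai k hkp hkj, aj, ← hK, add_right_comm, ← hck, ck]; abel

/-- **Theorem of Hall**: a function on a finite abelian group with sum zero is a difference of two
permutations. -/
theorem exists_perm_add_eq_of_sum_eq_zero (n : ℕ) :
    ∀ b : Γ → Γ, #{i | b i ≠ 0} = n → ∑ i, b i = 0 →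
      ∃ a c : Equiv.Perm Γ, ∀ i, c i = a i + b i := by
  induction n using Nat.strong_induction_on with
  | _ n ih =>
    intro b hn hb
    by_cases h0 : ∀ i, b i = 0
    · exact ⟨Equiv.refl _, Equiv.refl _, fun i => by simp [h0]⟩
    push Not at h0
    obtain ⟨i, hi⟩ := h0
    obtain ⟨j, hji, hj⟩ : ∃ j, j ≠ i ∧ b j ≠ 0 := by
      by_contra! h
      exact hi (by rw [← hb, Fintype.sum_eq_single i h])
    set b' : Γ → Γ := fun k => if k = i then 0 else if k = j then b j + b i else b k with hb'
    have hlt : #{k | b' k ≠ 0} < n := by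
      rw [← hn]
      refine card_lt_card ⟨fun k hk => ?_, fun h => ?_⟩
      · simp only [mem_filter, mem_univ, true_and, hb'] at hk ⊢
        split_ifs at hk with h1 h2
        · exact absurd rfl hk
        · rwa [h2]
        · exact hk
      · have := h (mem_filter.2 ⟨mem_univ i, hi⟩)
        simp [hb'] at this
    have hsum : ∑ k, b' k = 0 := by
      have e : ∀ k, b' k = b k + ((if k = i then - b i else 0) + if k = j then b i else 0) := by
        intro k
        simp only [hb']
        split_ifs with h1 h2 h2
        · exact absurd (h2.symm.trans h1) hji
        · simp [h1]
        · simp [h2]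
        · simp
      simp [e, sum_add_distrib, hb]
    obtain ⟨a, c, hac⟩ := ih _ hlt b' rfl hsum
    refine exists_perm_of_exchange hb a a.injective (a i + a j + b i) j _ ∅ a c i rfl (by simp)
      hji.symm ?_ (by simp) (by simp) (by simp) rfl
    intro k hki hkj
    rw [hac]
    simp [hb', hki, hkj]

/-- If the multiplicities `t` sum to less than the order of the group, then there is a permutation
`c` whose displacement takes every value `y` at least `t y` times. -/
lemma exists_perm_displacement (t : Γ → ℕ) (ht : ∑ y, t y < Fintype.card Γ) :
    ∃ c : Equiv.Perm Γ, ∀ y, t y ≤ #{a | c a - a = y} := by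
  have hcard : Fintype.card (Σ y, Fin (t y)) ≤ Fintype.card {x : Γ // x ≠ 0} := by
    rw [Fintype.card_sigma, Fintype.card_subtype_compl, Fintype.card_subtype_eq]
    simp only [Fintype.card_fin]
    omega
  obtain ⟨e⟩ := Function.Embedding.nonempty_of_card_le hcard
  set g : Γ → Γ := Function.extend (fun z => (e z : Γ)) Sigma.fst (fun _ => 0) with hg
  have hinj : Function.Injective (fun z => (e z : Γ)) := Subtype.val_injective.comp e.injective
  set b : Γ → Γ := fun x => if x = 0 then -∑ x ∈ univ.erase 0, g x else g x with hb
  have hbe : ∀ z, b (e z) = z.1 := fun z => by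
    simp only [hb, (e z).2, if_false, hg]
    exact hinj.extend_apply _ _ z
  have hsum : ∑ x, b x = 0 := by
    rw [← add_sum_erase _ _ (mem_univ 0)]
    rw [sum_congr rfl fun x hx => show b x = g x by simp [hb, ne_of_mem_erase hx]]
    simp [hb]
  obtain ⟨a, c, hac⟩ := exists_perm_add_eq_of_sum_eq_zero _ b rfl hsum
  refine ⟨a.symm.trans c, fun y => ?_⟩
  rw [← Fintype.card_fin (t y), ← card_univ,
    ← card_image_of_injective univ (f := fun i : Fin (t y) => a (e ⟨y, i⟩))
      (fun i i' h => by simpa using hinj (a.injective h))]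
  refine card_le_card fun x hx => ?_
  obtain ⟨i, -, rfl⟩ := mem_image.1 hx
  simp [hac, hbe]

end Hall

/-- Fractional weights on `Γ`. -/
def IsWeight {Γ : Type} (μ : Γ → ℝ) : Prop := ∀ a, 0 ≤ μ a ∧ μ a ≤ 1

/-- A function of a weight which at small scale is dominated by its linearization,
up to an error `c`. -/
def NearlyLinear {Γ : Type} [Fintype Γ] (Θ : (Γ → ℝ) → ℝ) (c : ℝ) : Prop :=
  ∀ μ, IsWeight μ → ∃ L : (Γ → ℝ) →ₗ[ℝ] ℝ, ∀ h, IsWeight (μ + h) → ∑ a, |h a| ≤ 2 →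
    Θ (μ + h) ≤ Θ μ + L h + c

section Rounding

variable {Γ β : Type} [Fintype Γ] [DecidableEq Γ] [DecidableEq β]

lemma NearlyLinear.add {Θ Θ' : (Γ → ℝ) → ℝ} {c c' : ℝ} (h : NearlyLinear Θ c)
    (h' : NearlyLinear Θ' c') : NearlyLinear (fun μ => Θ μ + Θ' μ) (c + c') := by
  intro μ hμ
  obtain ⟨L, hL⟩ := h μ hμ
  obtain ⟨L', hL'⟩ := h' μ hμ
  refine ⟨L + L', fun g hg hg' => ?_⟩
  have := hL g hg hg'
  have := hL' g hg hg'
  simp only [LinearMap.add_apply]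
  linarith

lemma NearlyLinear.const_mul {Θ : (Γ → ℝ) → ℝ} {c k : ℝ} (h : NearlyLinear Θ c) (hk : 0 ≤ k) :
    NearlyLinear (fun μ => k * Θ μ) (k * c) := by
  intro μ hμ
  obtain ⟨L, hL⟩ := h μ hμ
  refine ⟨k • L, fun g hg hg' => ?_⟩
  have := mul_le_mul_of_nonneg_left (hL g hg hg') hk
  simp only [LinearMap.smul_apply, smul_eq_mul]
  linarith

lemma NearlyLinear.sum {ι : Type} {Θ : ι → (Γ → ℝ) → ℝ} {c : ℝ} (s : Finset ι)
    (h : ∀ i ∈ s, NearlyLinear (Θ i) c) :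
    NearlyLinear (fun μ => ∑ i ∈ s, Θ i μ) (#s * c) := by
  classical
  induction s using Finset.induction_on with
  | empty => intro μ _; exact ⟨0, fun g _ _ => by simp⟩
  | insert i s hi ih =>
    have := (h i (mem_insert_self i s)).add (ih fun j hj => h j (mem_insert_of_mem hj))
    simp only [sum_insert hi, card_insert_of_notMem hi]
    push_cast
    convert this using 1
    ring

lemma nearlyLinear_sq (s : Finset Γ) (k : ℝ) :
    NearlyLinear (fun μ : Γ → ℝ => (∑ a ∈ s, μ a - k) ^ 2) 4 := by
  intro μ _
  refine ⟨(2 * (∑ a ∈ s, μ a - k)) • ∑ a ∈ s, LinearMap.proj a, fun h _ hh => ?_⟩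
  have h1 : |∑ a ∈ s, h a| ≤ 2 := (abs_sum_le_sum_abs _ _).trans
    ((sum_le_sum_of_subset_of_nonneg (subset_univ s) fun _ _ _ => abs_nonneg _).trans hh)
  have h2 := sq_le_sq' (abs_le.1 h1).1 (abs_le.1 h1).2
  simp only [Pi.add_apply, sum_add_distrib, LinearMap.smul_apply, LinearMap.sum_apply,
    LinearMap.proj_apply, smul_eq_mul]
  nlinarith

lemma nearlyLinear_energy [AddCommGroup Γ] {w μ₀ : Γ → ℝ} (hw : ∀ a, |w a| ≤ 1)
    (hμ₀ : IsWeight μ₀) (π : Equiv.Perm Γ) :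
    NearlyLinear (fun μ => energy fun s => w (π s) * (μ (π s) - μ₀ (π s)))
      (72 * Fintype.card Γ) := by
  intro μ hμ
  set g : Γ → ℝ := fun s => w (π s) * (μ (π s) - μ₀ (π s)) with hg
  have hg1 : ∀ s, |g s| ≤ 1 := fun s => by
    rw [hg, abs_mul]
    refine mul_le_one₀ (hw _) (abs_nonneg _) (abs_le.2 ⟨?_, ?_⟩) <;>
    linarith [(hμ (π s)).1, (hμ (π s)).2, (hμ₀ (π s)).1, (hμ₀ (π s)).2]
  refine ⟨∑ s, (4 * energyGrad g s * w (π s)) • LinearMap.proj (π s), fun h _ hh => ?_⟩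
  have h1 : ∑ s, |w (π s) * h (π s)| ≤ 2 := by
    refine le_trans ?_ hh
    rw [← Equiv.sum_comp π fun a => |h a|]
    refine sum_le_sum fun s _ => ?_
    rw [abs_mul]
    exact mul_le_of_le_one_left (abs_nonneg _) (hw _)
  have h2 := energy_add_le_linear hg1 h1
  have h3 : (fun s => w (π s) * ((μ + h) (π s) - μ₀ (π s))) =
      g + fun s => w (π s) * h (π s) := by
    funext s; simp only [hg, Pi.add_apply]; ring
  simp only [h3]
  refine h2.trans (le_of_eq ?_)
  simp only [LinearMap.sum_apply, LinearMap.smul_apply, LinearMap.proj_apply, smul_eq_mul, mul_sum]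
  congr 2
  exact sum_congr rfl fun s _ => by ring

lemma exists_rounding_step {Θ : (Γ → ℝ) → ℝ} {c : ℝ} (hΘ : NearlyLinear Θ c) (y : Γ → β)
    {μ : Γ → ℝ} (hμ : IsWeight μ) {a : Γ} (ha0 : μ a ≠ 0) (ha1 : μ a ≠ 1) :
    ∃ ν, IsWeight ν ∧ Θ ν ≤ Θ μ + c ∧ (∀ b, μ b = 0 → ν b = 0) ∧ (∀ b, μ b = 1 → ν b = 1) ∧
      (∃ b, μ b ≠ 0 ∧ μ b ≠ 1 ∧ (ν b = 0 ∨ ν b = 1)) ∧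
      ∀ z, ∀ N : ℤ, (N ≤ ∑ b with y b = z, μ b → N ≤ ∑ b with y b = z, ν b) ∧
        (∑ b with y b = z, μ b ≤ N → ∑ b with y b = z, ν b ≤ N) := by
  obtain ⟨L, hL⟩ := hΘ μ hμ
  have hfrac : ∀ b, μ b ≠ 0 → μ b ≠ 1 → 0 < μ b ∧ μ b < 1 := fun b h0 h1 =>
    ⟨lt_of_le_of_ne (hμ b).1 h0.symm, lt_of_le_of_ne (hμ b).2 h1⟩
  by_cases hpair : ∃ b, b ≠ a ∧ y b = y a ∧ μ b ≠ 0 ∧ μ b ≠ 1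
  · obtain ⟨b, hba, hyb, hb0, hb1⟩ := hpair
    have key : ∃ p q, p ≠ q ∧ y p = y q ∧ μ p ≠ 0 ∧ μ p ≠ 1 ∧ μ q ≠ 0 ∧ μ q ≠ 1 ∧
        L (Pi.single p 1) ≤ L (Pi.single q 1) := by
      rcases le_total (L (Pi.single a 1)) (L (Pi.single b 1)) with h | h
      · exact ⟨a, b, hba.symm, hyb.symm, ha0, ha1, hb0, hb1, h⟩
      · exact ⟨b, a, hba, hyb, hb0, hb1, ha0, ha1, h⟩
    obtain ⟨p, q, hpq, hy, hp0, hp1, hq0, hq1, hLpq⟩ := key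
    have hp := hfrac p hp0 hp1
    have hq := hfrac q hq0 hq1
    set s := min (1 - μ p) (μ q) with hs
    have hs0 : 0 ≤ s := le_min (by linarith) hq.1.le
    have hs1 : s ≤ 1 - μ p := min_le_left _ _
    have hs2 : s ≤ μ q := min_le_right _ _
    set h : Γ → ℝ := s • (Pi.single p 1 - Pi.single q 1) with hh
    have hhp : h p = s := by simp [hh, hpq]
    have hhq : h q = -s := by simp [hh, hpq.symm]
    have hho : ∀ b, b ≠ p → b ≠ q → h b = 0 := fun b h1 h2 => by simp [hh, h1, h2]
    have hwt : IsWeight (μ + h) := by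
      intro b
      rw [Pi.add_apply]
      by_cases h1 : b = p
      · rw [h1, hhp]; constructor <;> linarith
      by_cases h2 : b = q
      · rw [h2, hhq]; constructor <;> linarith
      · rw [hho b h1 h2, add_zero]; exact hμ b
    have hsum : ∑ b, |h b| ≤ 2 := by
      calc ∑ b, |h b| = ∑ b, ((if b = p then s else 0) + if b = q then s else 0) := by
            refine sum_congr rfl fun b _ => ?_
            by_cases h1 : b = p
            · rw [h1, hhp]; simp [hpq, abs_of_nonneg hs0]
            by_cases h2 : b = q
            · rw [h2, hhq]; simp [hpq.symm, abs_of_nonneg hs0]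
            · rw [hho b h1 h2]; simp [h1, h2]
        _ ≤ 2 := by
            rw [sum_add_distrib]; simp; linarith [hp.1]
    have hclass : ∀ z, ∑ b with y b = z, (μ + h) b = ∑ b with y b = z, μ b := by
      intro z
      have e : ∀ r, ∑ b with y b = z, (Pi.single r 1 : Γ → ℝ) b = if y r = z then 1 else 0 := by
        intro r
        simp [Pi.single_apply, sum_ite_eq']
      simp only [Pi.add_apply, sum_add_distrib, hh, Pi.smul_apply, Pi.sub_apply, smul_eq_mul,
        ← mul_sum, sum_sub_distrib, e, hy]
      ring
    refine ⟨μ + h, hwt, ?_, ?_, ?_, ?_, fun z N => ?_⟩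
    · have h1 := hL h hwt hsum
      have h2 : L h ≤ 0 := by
        rw [hh, map_smul, map_sub, smul_eq_mul]
        exact mul_nonpos_of_nonneg_of_nonpos hs0 (by linarith)
      linarith
    · intro b hb
      rw [Pi.add_apply, hho b (fun e => hp0 (e ▸ hb)) (fun e => hq0 (e ▸ hb)), hb, add_zero]
    · intro b hb
      rw [Pi.add_apply, hho b (fun e => hp1 (e ▸ hb)) (fun e => hq1 (e ▸ hb)), hb, add_zero]
    · rcases min_choice (1 - μ p) (μ q) with h1 | h1
      · exact ⟨p, hp0, hp1, Or.inr (by rw [Pi.add_apply, hhp, hs, h1]; ring)⟩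
      · exact ⟨q, hq0, hq1, Or.inl (by rw [Pi.add_apply, hhq, hs, h1]; ring)⟩
    · rw [hclass]; exact ⟨id, id⟩
  · push Not at hpair
    have ha := hfrac a ha0 ha1
    obtain ⟨s, hs, hLs⟩ : ∃ s : ℝ, (μ a + s = 0 ∨ μ a + s = 1) ∧ s * L (Pi.single a 1) ≤ 0 := by
      rcases le_total (L (Pi.single a 1)) 0 with h | h
      · exact ⟨1 - μ a, Or.inr (by ring),
          mul_nonpos_of_nonneg_of_nonpos (by linarith) h⟩
      · exact ⟨-μ a, Or.inl (by ring), mul_nonpos_of_nonpos_of_nonneg (by linarith) h⟩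
    have hs1 : |s| ≤ 1 := by
      rw [abs_le]; rcases hs with h | h <;> constructor <;> linarith
    set h : Γ → ℝ := s • Pi.single a 1 with hh
    have hha : h a = s := by simp [hh]
    have hho : ∀ b, b ≠ a → h b = 0 := fun b h1 => by simp [hh, h1]
    have hwt : IsWeight (μ + h) := by
      intro b
      rw [Pi.add_apply]
      by_cases h1 : b = a
      · rw [h1, hha]; rcases hs with h | h <;> rw [h] <;> norm_num
      · rw [hho b h1, add_zero]; exact hμ b
    refine ⟨μ + h, hwt, ?_, ?_, ?_, ⟨a, ha0, ha1, ?_⟩, fun z N => ?_⟩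
    · have h1 := hL h hwt (by
        rw [Fintype.sum_eq_single a fun b hb => by rw [hho b hb, abs_zero], hha]
        linarith)
      rw [hh, map_smul, smul_eq_mul, ← hh] at h1
      linarith
    · intro b hb
      rw [Pi.add_apply, hho b (fun e => ha0 (e ▸ hb)), hb, add_zero]
    · intro b hb
      rw [Pi.add_apply, hho b (fun e => ha1 (e ▸ hb)), hb, add_zero]
    · rwa [Pi.add_apply, hha]
    · by_cases hz : y a = z
      · have hmem : a ∈ ({b | y b = z} : Finset Γ) := by simpa using hz
        obtain ⟨J, hJ⟩ : ∃ J : ℤ, ∑ b ∈ ({b | y b = z} : Finset Γ).erase a, μ b = J := by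
          have : ∀ b ∈ ({b | y b = z} : Finset Γ).erase a, ∃ k : ℤ, μ b = k := by
            intro b hb
            rw [mem_erase, mem_filter] at hb
            by_cases h0 : μ b = 0
            · exact ⟨0, by simp [h0]⟩
            · exact ⟨1, by simp [hpair b hb.1 (hb.2.2.trans hz.symm) h0]⟩
          choose! k hk using this
          exact ⟨∑ b ∈ ({b | y b = z} : Finset Γ).erase a, k b, by
            push_cast; exact sum_congr rfl hk⟩
        have e1 : ∑ b with y b = z, μ b = μ a + J := by
          rw [← add_sum_erase _ _ hmem, hJ]
        have e2 : ∑ b with y b = z, (μ + h) b = (μ a + s) + J := by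
          rw [← add_sum_erase _ _ hmem, ← hJ, Pi.add_apply, hha]
          congr 1
          exact sum_congr rfl fun b hb => by
            rw [Pi.add_apply, hho b (ne_of_mem_erase hb), add_zero]
        rw [e1, e2]
        constructor <;> intro hN
        · have : (N : ℝ) < J + 1 := by linarith
          have : N < J + 1 := by exact_mod_cast this
          have : (N : ℝ) ≤ J := by exact_mod_cast Int.lt_add_one_iff.1 this
          rcases hs with h | h <;> rw [h] <;> linarith
        · have : (J : ℝ) < N := by linarith
          have : J < N := by exact_mod_cast this
          have : (J : ℝ) + 1 ≤ N := by exact_mod_cast Int.add_one_le_iff.2 this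
          rcases hs with h | h <;> rw [h] <;> linarith
      · have : ∑ b with y b = z, (μ + h) b = ∑ b with y b = z, μ b := by
          refine sum_congr rfl fun b hb => ?_
          rw [Pi.add_apply, hho b (fun e => hz (e ▸ (mem_filter.1 hb).2)), add_zero]
        rw [this]
        exact ⟨id, id⟩

/-- Rounding of a fractional weight to a set, not increasing a nearly linear potential much and
keeping the weight of every fibre of `y` between the same integers. -/
lemma exists_rounding {Θ : (Γ → ℝ) → ℝ} {c : ℝ} (hc : 0 ≤ c) (hΘ : NearlyLinear Θ c) (y : Γ → β)
    {μ : Γ → ℝ} (hμ : IsWeight μ) :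
    ∃ M : Finset Γ, Θ (ind M) ≤ Θ μ + Fintype.card Γ * c ∧ (∀ b, μ b = 0 → b ∉ M) ∧
      ∀ z, ∀ N : ℤ, (N ≤ ∑ b with y b = z, μ b → N ≤ #{b ∈ M | y b = z}) ∧
        (∑ b with y b = z, μ b ≤ N → #{b ∈ M | y b = z} ≤ N) := by
  suffices H : ∀ n, ∀ μ : Γ → ℝ, IsWeight μ → #{a | μ a ≠ 0 ∧ μ a ≠ 1} = n →
      ∃ M : Finset Γ, Θ (ind M) ≤ Θ μ + n * c ∧ (∀ b, μ b = 0 → b ∉ M) ∧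
      ∀ z, ∀ N : ℤ, (N ≤ ∑ b with y b = z, μ b → N ≤ #{b ∈ M | y b = z}) ∧
        (∑ b with y b = z, μ b ≤ N → #{b ∈ M | y b = z} ≤ N) by
    obtain ⟨M, h1, h2⟩ := H _ μ hμ rfl
    refine ⟨M, h1.trans ?_, h2⟩
    gcongr
    exact card_le_univ _
  intro n
  induction n using Nat.strong_induction_on with
  | _ n ih =>
    intro μ hμ hn
    by_cases h0 : ∀ a, μ a = 0 ∨ μ a = 1
    · refine ⟨({a | μ a = 1} : Finset Γ), ?_, fun b hb => by simp [hb], fun z N => ?_⟩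
      · have : ind ({a | μ a = 1} : Finset Γ) = μ := by
          funext a
          rcases h0 a with h | h <;> simp [ind, h]
        rw [this]
        have : 0 ≤ n * c := by positivity
        linarith
      · have : (∑ b with y b = z, μ b) = #{b ∈ ({a | μ a = 1} : Finset Γ) | y b = z} := by
          rw [card_eq_sum_ones, filter_comm, sum_filter (fun a => μ a = 1)]
          push_cast
          refine sum_congr rfl fun b _ => ?_
          rcases h0 b with h | h <;> simp [h]
        rw [this]
        constructor <;> intro h <;> exact_mod_cast h
    · push Not at h0
      obtain ⟨a, ha0, ha1⟩ := h0
      obtain ⟨ν, hν, hΘν, h0, h1, ⟨b, hb0, hb1, hb⟩, hcl⟩ := exists_rounding_step hΘ y hμ ha0 ha1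
      have hlt : #{a | ν a ≠ 0 ∧ ν a ≠ 1} < n := by
        rw [← hn]
        refine card_lt_card ⟨fun e he => ?_, fun h => ?_⟩
        · simp only [mem_filter, mem_univ, true_and] at he ⊢
          exact ⟨fun h => he.1 (h0 e h), fun h => he.2 (h1 e h)⟩
        · have := h (mem_filter.2 ⟨mem_univ b, hb0, hb1⟩)
          simp only [mem_filter, mem_univ, true_and] at this
          rcases hb with hb | hb
          exacts [this.1 hb, this.2 hb]
      obtain ⟨M, hM1, hM2, hM3⟩ := ih _ hlt ν hν rfl
      refine ⟨M, ?_, fun e he => hM2 e (h0 e he), fun z N => ?_⟩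
      · have : ((#{a | ν a ≠ 0 ∧ ν a ≠ 1} : ℝ) + 1) * c ≤ n * c := by
          gcongr
          exact_mod_cast hlt
        linarith
      · exact ⟨fun h => (hM3 z N).1 ((hcl z N).1 h), fun h => (hM3 z N).2 ((hcl z N).2 h)⟩

end Rounding

section Foundation

variable {Γ : Type} [AddCommGroup Γ] [Fintype Γ] [DecidableEq Γ]

lemma energy_zero : energy (fun _ : Γ => 0) = 0 := by simp [energy, corr]

lemma energy_neg (g : Γ → ℝ) : energy (fun s => - g s) = energy g := by simp [energy, corr]

lemma energy_bal_le {U : Finset Γ} {g : Γ → ℝ} (k : ℝ) (h : ∀ s, ind U s = k + g s) :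
    energy (bal U) ≤ energy g := by
  refine (energy_add_const_of_sum_eq_zero (bal U) (sum_bal U)
    (#U / Fintype.card Γ - k)).trans (le_of_eq ?_)
  congr 1
  funext s
  rw [bal, h]
  ring

lemma abs_sum_le_of_energy_le {g : Γ → ℝ} {b δ : ℝ} (hδ : 0 ≤ δ)
    (hg : energy g ≤ b * Fintype.card Γ ^ 2) (hb : b ≤ δ ^ 4 * Fintype.card Γ) :
    |∑ s, g s| ≤ δ * Fintype.card Γ := by
  refine abs_le_of_pow_four_le ((sum_pow_four_le g).trans ?_) (by positivity)
  calc (Fintype.card Γ : ℝ) * energy g ≤ Fintype.card Γ * (b * Fintype.card Γ ^ 2) := by gcongr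
    _ ≤ Fintype.card Γ * ((δ ^ 4 * Fintype.card Γ) * Fintype.card Γ ^ 2) := by gcongr
    _ = _ := by ring

lemma nearlyLinear_energy_add_energy {w μ₀ : Γ → ℝ} (hw : ∀ a, |w a| ≤ 1) (hμ₀ : IsWeight μ₀)
    (π : Equiv.Perm Γ) :
    NearlyLinear (fun μ => energy (fun s => w s * (μ s - μ₀ s)) +
      energy (fun s => w (π s) * (μ (π s) - μ₀ (π s)))) (144 * Fintype.card Γ) := by
  have h1 := nearlyLinear_energy hw hμ₀ (Equiv.refl Γ)
  have h2 := h1.add (nearlyLinear_energy hw hμ₀ π)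
  simp only [Equiv.refl_apply] at h2
  convert h2 using 1
  ring

lemma energy_combine {e₁ e₂ e₃ e₄ : Γ → ℝ} {c₁ c₂ : ℝ} (h₁ : |c₁| ≤ 1) (h₂ : |c₂| ≤ 1) :
    energy (fun s => (c₁ * e₁ s + c₂ * e₂ s) + (-e₃ s + -e₄ s)) ≤
      64 * (energy e₁ + energy e₂ + energy e₃ + energy e₄) := by
  have a := energy_add_le (fun s => c₁ * e₁ s + c₂ * e₂ s) (fun s => -e₃ s + -e₄ s)
  have b := energy_add_le (fun s => c₁ * e₁ s) (fun s => c₂ * e₂ s)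
  have c := energy_add_le (fun s => -e₃ s) (fun s => -e₄ s)
  have d := energy_const_mul_le h₁ e₁
  have e := energy_const_mul_le h₂ e₂
  rw [energy_neg, energy_neg] at c
  simp only [Pi.add_def] at a b c
  linarith

/-- Pseudorandom sets `A` and `Q` of density `α` and `M` of density `q` outside `A` and `Q`. -/
lemma exists_pseudorandom (c : Equiv.Perm Γ) (y : Γ → Γ) {α q K : ℝ} (hα0 : 0 ≤ α) (hα1 : α ≤ 1)
    (hq0 : 0 ≤ q) (hq1 : q ≤ 1) (hK : 0 ≤ K) (Y : Finset Γ) :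
    ∃ A Q M : Finset Γ, Disjoint A M ∧ Disjoint Q M ∧
      energy (fun s => ind A s - α) ≤ 144 * Fintype.card Γ ^ 2 ∧
      energy (fun s => ind A (c.symm s) - α) ≤ 144 * Fintype.card Γ ^ 2 ∧
      energy (fun s => (1 - ind A s) * (ind Q s - α)) +
        energy (fun s => (1 - ind A (c.symm s)) * (ind Q (c.symm s) - α)) +
        energy (fun s => ind Q (c.symm s) - α) +
        K * ∑ y ∈ Y, ((#{u ∈ A | c.symm (y + u) ∈ Q} : ℝ) - α * #A) ^ 2 ≤
        216 * Fintype.card Γ ^ 2 + 4 * K * #Y * Fintype.card Γ ∧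
      energy (fun s => ind M s - q * ((1 - ind A s) * (1 - ind Q s))) ≤
        144 * Fintype.card Γ ^ 2 ∧
      energy (fun s => ind M (c.symm s) -
        q * ((1 - ind A (c.symm s)) * (1 - ind Q (c.symm s)))) ≤ 144 * Fintype.card Γ ^ 2 ∧
      ∀ z, ∀ N : ℤ, (N ≤ q * ((1 - 2 * α) * #{a | y a = z} - 2) → N ≤ #{a ∈ M | y a = z}) := by
  have hα : IsWeight fun _ : Γ => α := fun _ => ⟨hα0, hα1⟩
  have h1abs : ∀ a : Γ, |(fun _ : Γ => (1 : ℝ)) a| ≤ 1 := fun _ => by simp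
  obtain ⟨A, hA1, -, hA3⟩ := exists_rounding (by positivity)
    (nearlyLinear_energy_add_energy h1abs hα c.symm) y hα
  have hwA : ∀ a, |(fun a => 1 - ind A a) a| ≤ 1 := fun a => by
    rw [abs_le]; constructor <;> linarith [ind_nonneg A a, ind_le_one A a]
  set T : Γ → Finset Γ := fun y => A.image fun u => c.symm (y + u) with hT
  have hTinj : ∀ y, Function.Injective fun u => c.symm (y + u) := fun y u v h => by simpa using h
  have hTc : ∀ y, #(T y) = #A := fun y => card_image_of_injective _ (hTinj y)
  have hΨ : NearlyLinear (fun μ : Γ → ℝ => ∑ y ∈ Y, (∑ a ∈ T y, μ a - α * #A) ^ 2) (#Y * 4) :=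
    NearlyLinear.sum Y fun y _ => nearlyLinear_sq (T y) (α * #A)
  obtain ⟨Q, hQ1, -, hQ3⟩ := exists_rounding (by positivity)
    (((nearlyLinear_energy_add_energy hwA hα c.symm).add
      (nearlyLinear_energy h1abs hα c.symm)).add (hΨ.const_mul hK)) y hα
  have hv : IsWeight fun a => q * ((1 - ind A a) * (1 - ind Q a)) := fun a => by
    have a1 := ind_nonneg A a
    have a2 := ind_le_one A a
    have b1 := ind_nonneg Q a
    have b2 := ind_le_one Q a
    have e1 : 0 ≤ 1 - ind A a := by linarith
    have e2 : 0 ≤ 1 - ind Q a := by linarith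
    refine ⟨by positivity, mul_le_one₀ hq1 (by positivity)
      (mul_le_one₀ (by linarith) e2 (by linarith))⟩
  obtain ⟨M, hM1, hM2, hM3⟩ := exists_rounding (by positivity)
    (nearlyLinear_energy_add_energy h1abs hv c.symm) y hv
  simp only [one_mul, sub_self, mul_zero, energy_zero, zero_add, add_zero] at hA1 hQ1 hM1
  refine ⟨A, Q, M, ?_, ?_, ?_, ?_, ?_, ?_, ?_, fun z N hN => ?_⟩
  · refine disjoint_left.2 fun a ha haM => hM2 a ?_ haM
    simp [ind, ha]
  · refine disjoint_left.2 fun a ha haM => hM2 a ?_ haM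
    simp [ind, ha]
  · have := energy_nonneg fun s => ind A (c.symm s) - α
    linarith
  · have := energy_nonneg fun s => ind A s - α
    linarith
  · have e1 : ∀ y, ∑ a ∈ T y, ind Q a = #{u ∈ A | c.symm (y + u) ∈ Q} := fun y => by
      rw [sum_image fun u _ v _ h => hTinj y h]
      simp [ind]
    have e2 : ∀ y, ∑ a ∈ T y, α - α * #A = 0 := fun y => by
      rw [sum_const, hTc, nsmul_eq_mul]; ring
    simp only [e1, e2] at hQ1
    simp only [ne_eq, OfNat.ofNat_ne_zero, not_false_eq_true, zero_pow, sum_const_zero, mul_zero,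
      zero_add] at hQ1
    refine hQ1.trans (le_of_eq ?_)
    ring
  · have := energy_nonneg fun s => ind M (c.symm s) -
        q * ((1 - ind A (c.symm s)) * (1 - ind Q (c.symm s)))
    linarith
  · have := energy_nonneg fun s => ind M s - q * ((1 - ind A s) * (1 - ind Q s))
    linarith
  · refine (hM3 z N).1 (hN.trans ?_)
    rw [← mul_sum]
    refine mul_le_mul_of_nonneg_left ?_ hq0
    have hc : ∀ R : Finset Γ, (∀ z, ∀ N : ℤ, ((N : ℝ) ≤ ∑ b with y b = z, α →
        N ≤ #{b ∈ R | y b = z}) ∧ (∑ b with y b = z, α ≤ N → #{b ∈ R | y b = z} ≤ N)) →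
        ∑ b with y b = z, ind R b ≤ α * #{a | y a = z} + 1 := by
      intro R hR
      have e1 : ∑ b with y b = z, α = α * #{a | y a = z} := by
        rw [sum_const, nsmul_eq_mul, mul_comm]
      have h1 := (hR z ⌈α * #{a | y a = z}⌉).2 (by rw [e1]; exact Int.le_ceil _)
      have h2 := (Int.ceil_lt_add_one (α * #{a | y a = z})).le
      have e2 : (∑ b with y b = z, ind R b) = #{b ∈ R | y b = z} := by
        simp only [ind, sum_boole]
        congr 2
        ext; simp [and_comm]
      rw [e2]
      have h3 : (#{b ∈ R | y b = z} : ℝ) ≤ ⌈α * #{a | y a = z}⌉ := by exact_mod_cast h1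
      linarith
    have hA := hc A hA3
    have hQ := hc Q hQ3
    calc (1 - 2 * α) * #{a | y a = z} - 2 ≤
          ∑ b with y b = z, (1 - ind A b - ind Q b) := by
          simp only [sum_sub_distrib, sum_const, nsmul_eq_mul, mul_one]
          linarith
      _ ≤ _ := sum_le_sum fun b _ => by
          nlinarith [mul_nonneg (ind_nonneg A b) (ind_nonneg Q b)]

lemma exists_injOn_of_card_le {α β : Type} [Nonempty β] (s : Finset α) (t : Finset β) (k : ℕ)
    (h : #s ≤ #t + k) : ∃ s' ⊆ s, #s ≤ #s' + k ∧ ∃ f : α → β, Set.InjOn f s' ∧ ∀ i ∈ s', f i ∈ t := by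
  obtain ⟨s', hs', hc⟩ := exists_subset_card_eq (min_le_left #s #t)
  refine ⟨s', hs', by omega, ?_⟩
  obtain ⟨f, hf, hinj⟩ := (s'.finite_toSet).exists_injOn_of_encard_le (t := (t : Set β)) (by
    rw [Set.encard_coe_eq_coe_finsetCard, Set.encard_coe_eq_coe_finsetCard, hc]
    exact_mod_cast min_le_right _ _)
  exact ⟨f, hinj, fun i hi => by simpa using hf hi⟩

lemma ind_eq_of_disjoint {A M U : Finset Γ} (h : Disjoint A M) {s a : Γ}
    (hs : s ∈ U ↔ a ∉ A ∧ a ∉ M) : ind U s = 1 - ind A a - ind M a := by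
  simp only [ind, hs]
  have := fun h' : a ∈ A => disjoint_left.1 h h'
  by_cases ha : a ∈ A
  · simp [ha, this ha]
  · by_cases hb : a ∈ M <;> simp [ha, hb]

set_option maxHeartbeats 1000000 in
/-- The starting configuration: most vertices of `I` (whose parents are labelled through `x` in
the small set `Y`) are placed so that the unused labels `U` and unused sums `S` are pseudorandom,
and pseudorandom reserves `A` of labels and `B` of sums remain untouched. -/
lemma exists_foundation {V : Type} [DecidableEq V] {ε α : ℝ} (hε : 0 < ε) (hε1 : ε ≤ 1)
    (hα : α = ε / 64) (hm : 432 ≤ (α / 16) ^ 4 * Fintype.card Γ) (Y : Finset Γ)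
    (hY : (#Y : ℝ) ≤ α ^ 4 / 128 * Fintype.card Γ) (I : Finset V) (x : V → Γ)
    (hx : ∀ i ∈ I, x i ∈ Y) (hI : (#I : ℝ) ≤ (1 - ε) * Fintype.card Γ) :
    ∃ A B U S : Finset Γ, ∃ I' ⊆ I, ∃ u : V → Γ, Disjoint A U ∧ Disjoint B S ∧
      Set.InjOn u I' ∧ Set.InjOn (fun i => x i + u i) I' ∧
      (∀ i ∈ I', u i ∉ A ∧ u i ∉ U ∧ x i + u i ∉ B ∧ x i + u i ∉ S) ∧
      #(I \ I') ≤ 4 * #Y ∧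
      α / 2 * Fintype.card Γ ≤ #A ∧ α / 2 * Fintype.card Γ ≤ #B ∧
      (1 - ε / 2) * Fintype.card Γ - #I ≤ #U ∧ (1 - ε / 2) * Fintype.card Γ - #I ≤ #S ∧
      energy (bal U) + energy (bal S) ≤ 200000 * Fintype.card Γ ^ 2 ∧
      energy (bal B) ≤ 432 * Fintype.card Γ ^ 2 ∧
      ∀ y ∈ Y, α ^ 2 / 2 * Fintype.card Γ ≤ #{u ∈ A | y + u ∈ B} := by
  have hm0 : (0 : ℝ) < Fintype.card Γ := by exact_mod_cast Fintype.card_pos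
  set m : ℝ := (Fintype.card Γ : ℝ) with hmdef
  have hα0 : 0 < α := by rw [hα]; positivity
  have hα1 : α ≤ 1 / 64 := by rw [hα]; linarith
  set q : ℝ := #I / m + ε / 4 with hq
  have hIm : (#I : ℝ) / m ≤ 1 - ε := by rw [div_le_iff₀ hm0]; exact hI
  have hI0 : (0 : ℝ) ≤ #I / m := by positivity
  have hq0 : 0 < q := by rw [hq]; positivity
  have hq1 : q ≤ 1 := by linarith
  have hqm : q * m = #I + ε / 4 * m := by rw [hq]; field_simp
  set r := q * (1 - 2 * α) with hr
  have hr0 : 0 < r := mul_pos hq0 (by linarith)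
  have hr1 : r ≤ 1 := by rw [hr]; nlinarith
  have hrm : #I < r * m := by
    have : r * m = #I + ε / 4 * m - 2 * α * (q * m) := by rw [hr, ← hqm]; ring
    rw [this]
    have h1 : 2 * α * (q * m) ≤ 2 * α * (1 * m) := by gcongr
    rw [hα] at h1 ⊢
    linarith [mul_pos hε hm0]
  set Iy : Γ → Finset V := fun y => {i ∈ I | x i = y} with hIy
  have hIsum : ∑ y ∈ Y, #(Iy y) = #I := (card_eq_sum_card_fiberwise hx).symm
  have hIsum' : ∑ y, #(Iy y) = #I :=
    (card_eq_sum_card_fiberwise (t := univ) fun _ _ => by simp).symm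
  obtain ⟨c, hc⟩ := exists_perm_displacement (fun y => ⌊#(Iy y) / r⌋₊) (by
    have h1 : ((∑ y, ⌊#(Iy y) / r⌋₊ : ℕ) : ℝ) < Fintype.card Γ := by
      push_cast
      calc ∑ y, (⌊#(Iy y) / r⌋₊ : ℝ) ≤ ∑ y, #(Iy y) / r :=
            sum_le_sum fun y _ => Nat.floor_le (by positivity)
        _ = #I / r := by rw [← sum_div, ← hIsum']; push_cast; rfl
        _ < m := by rw [div_lt_iff₀ hr0]; linarith
    exact_mod_cast h1)
  set K : ℝ := 6912 / α ^ 4 with hK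
  have hK0 : 0 < K := by positivity
  obtain ⟨A, Q, M, hAM, hQM, hA1, hA2, hQ, hM1, hM2, hM3⟩ :=
    exists_pseudorandom c (fun a => c a - a) hα0.le (by linarith) hq0.le hq1 hK0.le Y
  set Ψ := ∑ y ∈ Y, ((#{u ∈ A | c.symm (y + u) ∈ Q} : ℝ) - α * #A) ^ 2 with hΨ
  have hΨ0 : 0 ≤ Ψ := sum_nonneg fun _ _ => sq_nonneg _
  have hKΨ0 : 0 ≤ K * Ψ := by positivity
  have hKY : 4 * K * #Y * m ≤ 216 * m ^ 2 := by
    calc 4 * K * #Y * m ≤ 4 * K * (α ^ 4 / 128 * m) * m := by gcongr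
      _ = _ := by rw [hK]; field_simp; norm_num
  have n1 := energy_nonneg fun s => (1 - ind A s) * (ind Q s - α)
  have n2 := energy_nonneg fun s => (1 - ind A (c.symm s)) * (ind Q (c.symm s) - α)
  have n3 := energy_nonneg fun s => ind Q (c.symm s) - α
  have hE2 : energy (fun s => (1 - ind A s) * (ind Q s - α)) ≤ 432 * m ^ 2 := by linarith
  have hE2' : energy (fun s => (1 - ind A (c.symm s)) * (ind Q (c.symm s) - α)) ≤ 432 * m ^ 2 := by
    linarith
  have hE4 : energy (fun s => ind Q (c.symm s) - α) ≤ 432 * m ^ 2 := by linarith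
  have hKΨ : K * Ψ ≤ 432 * m ^ 2 := by linarith
  clear n1 n2 n3
  set B := Q.map c.toEmbedding with hB
  set U := univ \ (A ∪ M) with hU
  set S := univ \ (B ∪ M.map c.toEmbedding) with hS
  have memmap : ∀ (R : Finset Γ) (s : Γ), s ∈ R.map c.toEmbedding ↔ c.symm s ∈ R := fun R s => by
    constructor
    · intro h
      obtain ⟨a, ha, rfl⟩ := mem_map.1 h
      simpa using ha
    · intro h
      exact mem_map.2 ⟨_, h, by simp⟩
  have memU : ∀ s, s ∈ U ↔ s ∉ A ∧ s ∉ M := fun s => by simp [hU]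
  have memS : ∀ s, s ∈ S ↔ c.symm s ∉ Q ∧ c.symm s ∉ M := fun s => by
    rw [hS, mem_sdiff, mem_union, hB, memmap, memmap]; simp
  have hs1 : 1 - q * (1 - α) ≤ 1 := by nlinarith
  have hs2 : 0 ≤ q * (1 - α) := mul_nonneg hq0.le (by linarith)
  have hs3 : q * (1 - α) ≤ 1 := mul_le_one₀ hq1 (by linarith) (by linarith)
  have hq1' : |q| ≤ 1 := by rw [abs_of_pos hq0]; exact hq1
  have hEU : energy (bal U) ≤ 64 * (1008 * m ^ 2) := by
    refine (energy_bal_le (1 - α - q * (1 - α) ^ 2) (fun s => ?_)).trans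
      ((energy_combine (e₁ := fun s => ind A s - α)
        (e₂ := fun s => (1 - ind A s) * (ind Q s - α)) (e₃ := fun s => ind M s -
          q * ((1 - ind A s) * (1 - ind Q s))) (e₄ := fun _ => 0)
        (c₁ := -(1 - q * (1 - α))) (c₂ := q) (abs_le.2 ⟨by linarith, by linarith⟩) hq1').trans ?_)
    · have h1 : ind U s = 1 - ind A s - ind M s := ind_eq_of_disjoint hAM (memU s)
      rw [h1]; ring
    · rw [energy_zero]; linarith
  have hES : energy (bal S) ≤ 64 * (1152 * m ^ 2) := by
    refine (energy_bal_le (1 - α - q * (1 - α) ^ 2) (fun s => ?_)).trans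
      ((energy_combine (e₁ := fun s => ind A (c.symm s) - α)
        (e₂ := fun s => (1 - ind A (c.symm s)) * (ind Q (c.symm s) - α))
        (e₃ := fun s => ind M (c.symm s) -
          q * ((1 - ind A (c.symm s)) * (1 - ind Q (c.symm s))))
        (e₄ := fun s => ind Q (c.symm s) - α)
        (c₁ := q * (1 - α)) (c₂ := q) (abs_le.2 ⟨by linarith, hs3⟩) hq1').trans ?_)
    · have h1 : ind S s = 1 - ind Q (c.symm s) - ind M (c.symm s) :=
        ind_eq_of_disjoint hQM (memS s)
      rw [h1]; ring
    · linarith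
  have hEB : energy (bal B) ≤ 432 * m ^ 2 := by
    refine (energy_bal_le α fun s => ?_).trans hE4
    simp [ind, hB]
  have hcardB : (#B : ℝ) = #Q := by rw [hB, card_map]
  -- sizes of the sets
  have hδ : (0 : ℝ) ≤ α / 16 := by positivity
  have hcA := abs_le.1 (abs_sum_le_of_energy_le hδ hA1 (by linarith))
  have hcM := abs_le.1 (abs_sum_le_of_energy_le hδ hM1 (by linarith))
  have hcQ := abs_le.1 (abs_sum_le_of_energy_le hδ hE4 (by linarith))
  rw [Equiv.sum_comp c.symm (fun s => ind Q s - α)] at hcQ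
  simp only [sum_sub_distrib, sum_ind, sum_const, card_univ, nsmul_eq_mul, ← hmdef] at hcA hcQ
  rw [sum_sub_distrib, sum_ind, ← mul_sum] at hcM
  have hvle : ∑ s, (1 - ind A s) * (1 - ind Q s) ≤ m := by
    calc ∑ s, (1 - ind A s) * (1 - ind Q s) ≤ ∑ _s : Γ, (1 : ℝ) :=
          sum_le_sum fun s _ => mul_le_one₀ (by linarith [ind_nonneg A s])
            (by linarith [ind_le_one Q s]) (by linarith [ind_nonneg Q s])
      _ = m := by simp [hmdef]
  have hqv := mul_le_mul_of_nonneg_left hvle hq0.le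
  have hcardM : (#M : ℝ) ≤ #I + ε / 4 * m + α / 16 * m := by linarith
  have hεα : ε = 64 * α := by rw [hα]; ring
  have hcardU : (1 - ε / 2) * m - #I ≤ #U := by
    have h1 : (#U : ℝ) = m - (#A + #M) := by
      rw [hU, card_univ_sdiff, card_union_of_disjoint hAM, Nat.cast_sub (by
        rw [← card_union_of_disjoint hAM]; exact card_le_univ _)]
      push_cast; rfl
    rw [h1]
    rw [hεα] at hcardM ⊢
    linarith [mul_pos hα0 hm0]
  have hcardS : (1 - ε / 2) * m - #I ≤ #S := by
    have hd : Disjoint B (M.map c.toEmbedding) := (disjoint_map _).2 hQM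
    have h1 : (#S : ℝ) = m - (#Q + #M) := by
      rw [hS, card_univ_sdiff, card_union_of_disjoint hd, Nat.cast_sub (by
        rw [← card_union_of_disjoint hd]; exact card_le_univ _), hB, card_map, card_map]
      push_cast; rfl
    rw [h1]
    rw [hεα] at hcardM ⊢
    linarith [mul_pos hα0 hm0]
  -- a large part of `I` is placed into `M`
  have hcount : ∀ y, #(Iy y) ≤ #{a ∈ M | c a - a = y} + 4 := by
    intro y
    have h1 : (((#(Iy y) : ℤ) - 4 : ℤ) : ℝ) ≤ q * ((1 - 2 * α) * #{a | c a - a = y} - 2) := by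
      have h2 : (#(Iy y) : ℝ) / r - 1 ≤ #{a | c a - a = y} :=
        (Nat.sub_one_lt_floor _).le.trans (Nat.cast_le.2 (hc y))
      have h3 : #(Iy y) - r ≤ r * #{a | c a - a = y} := by
        calc #(Iy y) - r = r * (#(Iy y) / r - 1) := by
              rw [mul_sub, mul_one, mul_div_cancel₀ _ hr0.ne']
          _ ≤ _ := mul_le_mul_of_nonneg_left h2 hr0.le
      push_cast
      have h4 : q * ((1 - 2 * α) * #{a | c a - a = y} - 2) = r * #{a | c a - a = y} - 2 * q := by
        rw [hr]; ring
      rw [h4]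
      linarith
    have := hM3 y _ h1
    omega
  choose I' hI'1 hI'2 g hg1 hg2 using fun y =>
    exists_injOn_of_card_le (Iy y) {a ∈ M | c a - a = y} 4 (hcount y)
  have hgx : ∀ i, i ∈ I' (x i) → g (x i) i ∈ M ∧ x i + g (x i) i = c (g (x i) i) := by
    intro i hi
    have := hg2 _ i hi
    rw [mem_filter] at this
    exact ⟨this.1, (sub_eq_iff_eq_add.1 this.2).symm⟩
  have hgx' : ∀ i, i ∈ I' (x i) → c (g (x i) i) - g (x i) i = x i := fun i hi => by
    rw [← (hgx i hi).2, add_sub_cancel_right]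
  have hinj : Set.InjOn (fun i => g (x i) i) ({i ∈ I | i ∈ I' (x i)} : Finset V) := by
    intro i hi j hj hij
    have hi' := (mem_filter.1 (mem_coe.1 hi)).2
    have hj' := (mem_filter.1 (mem_coe.1 hj)).2
    have hxx : x i = x j := by
      rw [← hgx' i hi', ← hgx' j hj']
      simp only at hij
      rw [hij]
    simp only [← hxx] at hij hj'
    exact hg1 (x i) hi' hj' hij
  refine ⟨A, B, U, S, {i ∈ I | i ∈ I' (x i)}, filter_subset _ _, fun i => g (x i) i, ?_, ?_, hinj,
    ?_, ?_, ?_, ?_, ?_, hcardU, hcardS, by linarith, hEB, ?_⟩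
  · exact disjoint_left.2 fun s hs hs' => ((memU s).1 hs').1 hs
  · exact disjoint_left.2 fun s hs hs' => ((memS s).1 hs').1 ((memmap Q s).1 hs)
  · intro i hi j hj hij
    have hi' := (mem_filter.1 (mem_coe.1 hi)).2
    have hj' := (mem_filter.1 (mem_coe.1 hj)).2
    simp only at hij
    rw [(hgx i hi').2, (hgx j hj').2] at hij
    exact hinj hi hj (c.injective hij)
  · intro i hi
    have hi' := (mem_filter.1 hi).2
    obtain ⟨h1, h2⟩ := hgx i hi'
    rw [h2, memU, memS, hB, memmap]
    simp only [Equiv.symm_apply_apply]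
    exact ⟨fun h => disjoint_left.1 hAM h h1, fun h => h.2 h1,
      fun h => disjoint_left.1 hQM h h1, fun h => h.2 h1⟩
  · have h1 : #(I \ {i ∈ I | i ∈ I' (x i)}) = ∑ y ∈ Y, #(Iy y \ I' y) := by
      rw [card_eq_sum_card_fiberwise (f := x) (t := Y) fun i hi => hx i (mem_sdiff.1 hi).1]
      refine sum_congr rfl fun y _ => ?_
      congr 1
      ext i
      simp only [hIy, mem_filter, mem_sdiff]
      constructor
      · rintro ⟨⟨h1, h2⟩, rfl⟩
        exact ⟨⟨h1, rfl⟩, fun h => h2 ⟨h1, h⟩⟩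
      · rintro ⟨⟨h1, rfl⟩, h2⟩
        exact ⟨⟨h1, fun h => h2 h.2⟩, rfl⟩
    rw [h1, mul_comm, ← smul_eq_mul]
    refine sum_le_card_nsmul _ _ _ fun y _ => ?_
    rw [card_sdiff_of_subset (hI'1 y)]
    have := hI'2 y
    omega
  · linarith
  · rw [hcardB]; linarith
  · intro y hy
    have h1 : ((#{u ∈ A | c.symm (y + u) ∈ Q} : ℝ) - α * #A) ^ 2 ≤ (α ^ 2 / 4 * m) ^ 2 := by
      have h2 : ((#{u ∈ A | c.symm (y + u) ∈ Q} : ℝ) - α * #A) ^ 2 ≤ Ψ :=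
        single_le_sum (f := fun y => ((#{u ∈ A | c.symm (y + u) ∈ Q} : ℝ) - α * #A) ^ 2)
          (fun _ _ => sq_nonneg _) hy
      refine h2.trans ?_
      have h3 : K * Ψ ≤ K * (α ^ 2 / 4 * m) ^ 2 := by
        refine hKΨ.trans (le_of_eq ?_)
        rw [hK]; field_simp; norm_num
      exact le_of_mul_le_mul_left h3 hK0
    have h4 := (abs_le.1 (abs_le_of_sq_le_sq h1 (by positivity))).1
    have h5 : #{u ∈ A | y + u ∈ B} = #{u ∈ A | c.symm (y + u) ∈ Q} := by
      simp only [hB, memmap]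
    rw [h5]
    have h6 : α * (15 / 16 * (α * m)) ≤ α * #A := by
      refine mul_le_mul_of_nonneg_left ?_ hα0.le
      linarith
    have h7 : 0 < α ^ 2 * m := by positivity
    linarith

end Foundation

section Reserve

variable {Γ : Type} [AddCommGroup Γ] [Fintype Γ] [DecidableEq Γ]

lemma sum_ind_mul_corr_ind (X U B : Finset Γ) :
    ∑ u, ind U u * corr (ind X) (ind B) u = ∑ u ∈ U, (#{x ∈ X | x + u ∈ B} : ℝ) := by
  simp only [ind, ite_mul, one_mul, zero_mul, sum_ite_mem, univ_inter, corr, card_filter]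
  push_cast
  rfl

lemma abs_sum_card_sub_le {δ : ℝ} (hδ : 0 ≤ δ) {B : Finset Γ}
    (hB : energy (bal B) ≤ δ ^ 4 * Fintype.card Γ ^ 3) (X U : Finset Γ) :
    |∑ u ∈ U, (#{x ∈ X | x + u ∈ B} : ℝ) - #B / Fintype.card Γ * #X * #U| ≤
      δ * Fintype.card Γ ^ 2 := by
  have h := abs_sum_ind_mul_corr_bal_le (ξ := ind X) (Δ := 1) (ind_nonneg X) (ind_le_one X)
    (by rw [sum_ind]; exact_mod_cast card_le_univ X) U B hδ hB (by simp)
  rw [← sum_ind_mul_corr_ind]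
  simp only [corr_ind_eq, mul_add, sum_add_distrib, sum_ind, ← sum_mul]
  convert h using 2
  ring

lemma exists_notMem_of_lt {β : Type} [DecidableEq β] {s t : Finset β} (h : (#t : ℝ) < #s) :
    ∃ a ∈ s, a ∉ t := exists_mem_notMem_of_card_lt_card (by exact_mod_cast h)

/-- Outside a small exceptional set `X`, labels can be joined through the reserves `A`, `B`:
directly by one new label, or pairwise by paths with two new labels. -/
lemma exists_reserve {α ω : ℝ} (hα : 0 < α) (hα1 : α ≤ 1) (hω : 0 < ω) (hωα : ω ≤ α ^ 5 / 4096)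
    (hm : 432 ≤ (ω * α ^ 2 / 64) ^ 4 * Fintype.card Γ) (hm' : 4 ≤ ω * Fintype.card Γ)
    {A B : Finset Γ} (hA : α / 2 * Fintype.card Γ ≤ #A) (hB : α / 2 * Fintype.card Γ ≤ #B)
    (hE : energy (bal B) ≤ 432 * Fintype.card Γ ^ 2) :
    ∃ X : Finset Γ, #X ≤ ω / 8 * Fintype.card Γ ∧
      (∀ y, α ^ 2 / 2 * Fintype.card Γ ≤ #{u ∈ A | y + u ∈ B} → y ∉ X) ∧
      (∀ F G : Finset Γ, #F ≤ ω * Fintype.card Γ → #G ≤ ω * Fintype.card Γ → ∀ y ∉ X,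
        ∃ u ∈ A, u ∉ F ∧ u ∉ X ∧ y + u ∈ B ∧ y + u ∉ G) ∧
      ∀ F G : Finset Γ, #F ≤ ω * Fintype.card Γ → #G ≤ ω * Fintype.card Γ → ∀ y ∉ X, ∀ z ∉ X,
        ∃ u ∈ A, ∃ v ∈ A, u ≠ v ∧ u ∉ F ∧ v ∉ F ∧ u ∉ X ∧ v ∉ X ∧ y + u ∈ B ∧ u + v ∈ B ∧
          z + v ∈ B ∧ y + u ∉ G ∧ u + v ∉ G ∧ z + v ∉ G ∧ y + u ≠ u + v ∧ u + v ≠ z + v ∧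
          y + u ≠ z + v := by
  have hm0 : (0 : ℝ) < Fintype.card Γ := by exact_mod_cast Fintype.card_pos
  set m : ℝ := (Fintype.card Γ : ℝ) with hmdef
  set δ := ω * α ^ 2 / 64 with hδ
  have hδ0 : 0 < δ := by positivity
  have hE' : energy (bal B) ≤ δ ^ 4 * m ^ 3 :=
    hE.trans (by
      calc 432 * m ^ 2 ≤ (δ ^ 4 * m) * m ^ 2 := by gcongr
        _ = _ := by ring)
  have hmix := abs_sum_card_sub_le hδ0.le hE'
  have hBm : α / 2 ≤ #B / m := by rwa [le_div_iff₀ hm0]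
  have hlow : ∀ X U : Finset Γ, α / 2 * #X * #U - δ * m ^ 2 ≤ ∑ u ∈ U, (#{x ∈ X | x + u ∈ B} : ℝ) :=
    fun X U => by
      have h1 := (abs_le.1 (hmix X U)).1
      have h2 : α / 2 * #X * #U ≤ #B / m * #X * #U := by gcongr
      linarith
  set X : Finset Γ := {x | (#{u ∈ A | x + u ∈ B} : ℝ) < α ^ 2 / 8 * m} with hX
  have hXc : #X ≤ ω / 8 * m := by
    have h1 := hlow A X
    have h2 : ∑ u ∈ X, (#{x ∈ A | x + u ∈ B} : ℝ) ≤ ∑ u ∈ X, α ^ 2 / 8 * m :=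
      sum_le_sum fun u hu => by
        have := (mem_filter.1 hu).2.le
        simpa only [add_comm] using this
    rw [sum_const, nsmul_eq_mul] at h2
    have h3 : α / 2 * (α / 2 * m) * #X ≤ α / 2 * #A * #X := by gcongr
    have h4 : (α ^ 2 / 8 * m) * #X ≤ (α ^ 2 / 8 * m) * (ω / 8 * m) := by
      rw [hδ] at h1
      linarith
    exact le_of_mul_le_mul_left h4 (by positivity)
  have hω8 : ω ≤ α ^ 2 / 4096 := hωα.trans (by
    have : α ^ 5 ≤ α ^ 2 := pow_le_pow_of_le_one hα.le hα1 (by norm_num)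
    linarith)
  -- many admissible labels next to a label outside `X`
  have hadm : ∀ F G : Finset Γ, #F ≤ ω * m → #G ≤ ω * m → ∀ y ∉ X, α ^ 2 / 16 * m <
      #{u ∈ A | y + u ∈ B ∧ u ∉ F ∧ u ∉ X ∧ y + u ∉ G} - 1 := by
    intro F G hF hG y hy
    have h1 : α ^ 2 / 8 * m ≤ #{u ∈ A | y + u ∈ B} := by simpa [hX] using hy
    have h2 : ({u ∈ A | y + u ∈ B} : Finset Γ) ⊆
        {u ∈ A | y + u ∈ B ∧ u ∉ F ∧ u ∉ X ∧ y + u ∉ G} ∪ (F ∪ (X ∪ G.image fun s => s - y)) := by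
      intro u hu
      simp only [mem_union, mem_filter, mem_image] at hu ⊢
      by_cases h : y + u ∈ G
      · exact Or.inr (Or.inr (Or.inr ⟨_, h, by abel⟩))
      · tauto
    have h3 := card_le_card h2
    have h4 := card_union_le {u ∈ A | y + u ∈ B ∧ u ∉ F ∧ u ∉ X ∧ y + u ∉ G}
      (F ∪ (X ∪ G.image fun s => s - y))
    have h5 := card_union_le F (X ∪ G.image fun s => s - y)
    have h6 := card_union_le X (G.image fun s => s - y)
    have h7 : #(G.image fun s => s - y) ≤ #G := card_image_le
    have h8 : (#{u ∈ A | y + u ∈ B} : ℝ) ≤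
        #{u ∈ A | y + u ∈ B ∧ u ∉ F ∧ u ∉ X ∧ y + u ∉ G} + (#F + (#X + #G)) := by
      exact_mod_cast by omega
    have h9 : ω * m ≤ α ^ 2 / 4096 * m := by gcongr
    have h10 : 0 < α ^ 2 * m := by positivity
    linarith
  refine ⟨X, hXc, fun y hy h => ?_, fun F G hF hG y hy => ?_, fun F G hF hG y hy z hz => ?_⟩
  · have := (mem_filter.1 h).2
    have h10 : 0 < α ^ 2 * m := by positivity
    linarith
  · have h1 := hadm F G hF hG y hy
    have h10 : 0 < α ^ 2 * m := by positivity
    have h2 : (0 : ℝ) < #{u ∈ A | y + u ∈ B ∧ u ∉ F ∧ u ∉ X ∧ y + u ∉ G} := by linarith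
    obtain ⟨u, hu⟩ := card_pos.1 (Nat.cast_pos.1 h2)
    obtain ⟨h3, h4, h5, h6, h7⟩ := mem_filter.1 hu
    exact ⟨u, h3, h5, h6, h4, h7⟩
  · set U₁ := {u ∈ A | y + u ∈ B ∧ u ∉ F ∧ u ∉ X ∧ y + u ∉ G}.erase z with hU₁
    set U₂ := {u ∈ A | z + u ∈ B ∧ u ∉ F ∧ u ∉ X ∧ z + u ∉ G} with hU₂
    have h1 : α ^ 2 / 16 * m ≤ #U₁ := by
      refine (hadm F G hF hG y hy).le.trans ?_
      have : #{u ∈ A | y + u ∈ B ∧ u ∉ F ∧ u ∉ X ∧ y + u ∉ G} ≤ #U₁ + 1 := by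
        exact Nat.sub_le_iff_le_add.1 pred_card_le_card_erase
      rw [sub_le_iff_le_add]
      exact_mod_cast this
    have h2 : α ^ 2 / 16 * m ≤ #U₂ := by linarith [hadm F G hF hG z hz]
    have h3 := hlow U₂ U₁
    have h4 : ∃ u ∈ U₁, ω * m + 3 < #{v ∈ U₂ | v + u ∈ B} := by
      by_contra! hcon
      have h5 : ∑ u ∈ U₁, (#{v ∈ U₂ | v + u ∈ B} : ℝ) ≤ m * (ω * m + 3) := by
        refine (sum_le_sum hcon).trans ?_
        rw [sum_const, nsmul_eq_mul]
        have : (#U₁ : ℝ) ≤ m := by rw [hmdef]; exact_mod_cast card_le_univ _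
        gcongr
      have h6 : α / 2 * (α ^ 2 / 16 * m) * (α ^ 2 / 16 * m) ≤ α / 2 * #U₂ * #U₁ := by gcongr
      have h7 : m * (ω * m + 3) ≤ m * (2 * (ω * m)) := by gcongr; linarith
      have h8 : δ * m ^ 2 ≤ ω * m ^ 2 := by
        gcongr
        rw [hδ]
        have : α ^ 2 ≤ 1 := pow_le_one₀ hα.le hα1
        nlinarith
      have h9 : ω * m ^ 2 ≤ α ^ 5 / 4096 * m ^ 2 := by gcongr
      have h10 : 0 < α ^ 5 * m ^ 2 := by positivity
      linarith
    obtain ⟨u, hu, hcard⟩ := h4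
    have h5 : #(G.image (fun s => s - u) ∪ {u, y, y + u - z}) ≤ #G + 3 :=
      (card_union_le _ _).trans (add_le_add card_image_le card_le_three)
    have h6 : (#(G.image (fun s => s - u) ∪ {u, y, y + u - z}) : ℝ) ≤ #G + 3 := by exact_mod_cast h5
    obtain ⟨v, hv, hv'⟩ := exists_notMem_of_lt
      (t := G.image (fun s => s - u) ∪ {u, y, y + u - z}) (by linarith :
        (_ : ℝ) < #{v ∈ U₂ | v + u ∈ B})
    simp only [hU₁, hU₂, mem_erase, mem_filter] at hu hv
    simp only [mem_union, mem_image, mem_insert, mem_singleton, not_or, not_exists, not_and] at hv'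
    obtain ⟨huz, huA, hyu, huF, huX, hyuG⟩ := hu
    obtain ⟨⟨hvA, hzv, hvF, hvX, hzvG⟩, hvu⟩ := hv
    obtain ⟨hv1, hv2, hv3, hv4⟩ := hv'
    refine ⟨u, huA, v, hvA, Ne.symm hv2, huF, hvF, huX, hvX, hyu, ?_, hzv, hyuG, ?_, hzvG, ?_, ?_,
      ?_⟩
    · rwa [add_comm]
    · exact fun h => hv1 _ h (by abel)
    · rw [add_comm y u]; exact fun h => hv3 (add_left_cancel h).symm
    · exact fun h => huz (add_right_cancel h)
    · exact fun h => hv4 (by rw [h]; abel)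

end Reserve

section RootedTree

variable {V : Type} [Fintype V] [DecidableEq V]

/-- The descendants of `v` under the parent map `par`, including `v`. -/
noncomputable def descendants (par : V → V) (v : V) : Finset V :=
  open Classical in {u | ∃ j, par^[j] u = v}

/-- The vertices with at least `K` descendants. -/
noncomputable def heavy (par : V → V) (K : ℕ) : Finset V := {v | K ≤ #(descendants par v)}

/-- The children of `v` in `C`. -/
def childrenIn (par : V → V) (r : V) (C : Finset V) (v : V) : Finset V := {u ∈ C | u ≠ r ∧ par u = v}

lemma mem_descendants {par : V → V} {u v : V} : u ∈ descendants par v ↔ ∃ j, par^[j] u = v := by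
  simp [descendants]

lemma mem_heavy {par : V → V} {K : ℕ} {v : V} : v ∈ heavy par K ↔ K ≤ #(descendants par v) := by
  simp [heavy]

lemma par_mem_heavy {par : V → V} {K : ℕ} {v : V} (h : v ∈ heavy par K) : par v ∈ heavy par K := by
  rw [mem_heavy] at h ⊢
  refine h.trans (card_le_card fun u hu => ?_)
  obtain ⟨j, rfl⟩ := mem_descendants.1 hu
  exact mem_descendants.2 ⟨j + 1, Function.iterate_succ_apply' _ _ _⟩

lemma iterate_mem_heavy {par : V → V} {K : ℕ} {v : V} (h : v ∈ heavy par K) (j : ℕ) :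
    par^[j] v ∈ heavy par K := by
  induction j with
  | zero => exact h
  | succ j ih => rw [Function.iterate_succ_apply']; exact par_mem_heavy ih

lemma exists_mem_childrenIn {par : V → V} {r : V} (hr : par r = r) {C : Finset V}
    (hC : ∀ v ∈ C, par v ∈ C) {v w : V} (hv : v ∈ C) (hvw : v ≠ w) {j : ℕ} (hj : par^[j] v = w) :
    (childrenIn par r C w).Nonempty := by
  induction j generalizing v with
  | zero => exact absurd hj hvw
  | succ j ih =>
    by_cases h : par v = w
    · refine ⟨v, mem_filter.2 ⟨hv, ?_, h⟩⟩
      rintro rfl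
      exact hvw (hr.symm.trans h)
    · exact ih (hC v hv) h hj

lemma sum_card_childrenIn_le (par : V → V) (r : V) (C : Finset V) :
    ∑ v, #(childrenIn par r C v) ≤ #C := by
  have h : ∀ v, childrenIn par r C v = {u ∈ {u ∈ C | u ≠ r} | par u = v} := fun v => by
    rw [childrenIn, filter_filter]
  simp only [h]
  rw [← card_eq_sum_card_fiberwise fun _ _ => by simp]
  exact card_filter_le _ _

lemma card_leaves_mul_le {par : V → V} {r : V} (hr : par r = r) (K : ℕ) :
    #{v ∈ heavy par K | childrenIn par r (heavy par K) v = ∅} * K ≤ Fintype.card V := by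
  have hd : Set.PairwiseDisjoint
      ({v ∈ heavy par K | childrenIn par r (heavy par K) v = ∅} : Finset V)
      (descendants par) := by
    intro v hv w hw hvw
    rw [Function.onFun, disjoint_left]
    intro u hu hu'
    simp only [coe_filter, Set.mem_ofPred_eq] at hv hw
    obtain ⟨i, hi⟩ := mem_descendants.1 hu
    obtain ⟨j, hj⟩ := mem_descendants.1 hu'
    rcases le_total i j with h | h
    · obtain ⟨k, rfl⟩ := Nat.exists_eq_add_of_le' h
      rw [Function.iterate_add_apply, hi] at hj
      have := exists_mem_childrenIn hr (fun _ => par_mem_heavy) hv.1 hvw hj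
      simp [hw.2] at this
    · obtain ⟨k, rfl⟩ := Nat.exists_eq_add_of_le' h
      rw [Function.iterate_add_apply, hj] at hi
      have := exists_mem_childrenIn hr (fun _ => par_mem_heavy) hw.1 hvw.symm hi
      simp [hv.2] at this
  have h := card_le_univ (({v ∈ heavy par K | childrenIn par r (heavy par K) v = ∅}).biUnion
    (descendants par))
  rw [card_biUnion hd] at h
  refine le_trans ?_ h
  rw [← smul_eq_mul]
  exact card_nsmul_le_sum _ _ _ fun v hv => mem_heavy.1 (mem_filter.1 hv).1

lemma card_branching_mul_le {par : V → V} {r : V} (hr : par r = r) (K : ℕ) :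
    #{v ∈ heavy par K | 2 ≤ #(childrenIn par r (heavy par K) v)} * K ≤ Fintype.card V := by
  refine le_trans (Nat.mul_le_mul_right _ ?_) (card_leaves_mul_le (r := r) hr K)
  set C := heavy par K
  have h1 : ∑ v ∈ C, #(childrenIn par r C v) ≤ #C :=
    (sum_le_sum_of_subset (subset_univ _)).trans (sum_card_childrenIn_le par r C)
  have h2 : ∑ v ∈ C, (1 + if 2 ≤ #(childrenIn par r C v) then 1 else 0) ≤
      ∑ v ∈ C, (#(childrenIn par r C v) + if childrenIn par r C v = ∅ then 1 else 0) := by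
    refine sum_le_sum fun v _ => ?_
    have : childrenIn par r C v = ∅ ↔ #(childrenIn par r C v) = 0 := card_eq_zero.symm
    simp only [this]
    split_ifs <;> omega
  rw [sum_add_distrib, sum_add_distrib, ← card_filter, ← card_filter, sum_const, smul_eq_mul,
    mul_one] at h2
  omega

lemma card_many_children_mul_le (par : V → V) (r : V) (K : ℕ) :
    #{v | K ≤ #(childrenIn par r univ v)} * K ≤ Fintype.card V := by
  refine le_trans ?_ (sum_card_childrenIn_le par r univ)
  rw [← smul_eq_mul]
  exact (card_nsmul_le_sum _ _ _ fun v hv => (mem_filter.1 hv).2).trans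
    (sum_le_sum_of_subset (subset_univ _))

lemma exists_residue_card_mul_le (dep : V → ℕ) {K : ℕ} (hK : 0 < K) (C : Finset V) :
    ∃ ρ < K, #{v ∈ C | dep v % K = ρ} * K ≤ #C := by
  by_contra! h
  have h1 : #C = ∑ ρ ∈ range K, #{v ∈ C | dep v % K = ρ} :=
    card_eq_sum_card_fiberwise fun v _ => by simpa using Nat.mod_lt _ hK
  have h2 : ∑ ρ ∈ range K, #C < ∑ ρ ∈ range K, #{v ∈ C | dep v % K = ρ} * K :=
    sum_lt_sum_of_nonempty (by simpa using hK.ne') fun ρ hρ => h ρ (mem_range.1 hρ)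
  rw [← sum_mul, ← h1, sum_const, card_range, smul_eq_mul, mul_comm] at h2
  exact lt_irrefl _ h2

lemma dep_iterate_add {par : V → V} {dep : V → ℕ} {r : V}
    (hdep : ∀ v, v ≠ r → dep v = dep (par v) + 1) {v : V} {j : ℕ} (h : ∀ i < j, par^[i] v ≠ r) :
    dep (par^[j] v) + j = dep v := by
  induction j with
  | zero => rfl
  | succ j ih =>
    rw [Function.iterate_succ_apply', ← ih fun i hi => h i (by omega), hdep _ (h j (by omega))]
    ring

lemma iterate_mem_heavy_of_ne {par : V → V} {dep : V → ℕ} {r : V}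
    (hdep : ∀ v, v ≠ r → dep v = dep (par v) + 1) {v : V} {K : ℕ} (h : ∀ i < K, par^[i] v ≠ r) :
    par^[K] v ∈ heavy par K := by
  rw [mem_heavy]
  have h1 : #((range K).image fun i => par^[i] v) = K := by
    rw [card_image_of_injOn, card_range]
    intro i hi j hj hij
    simp only [coe_range, Set.mem_Iio] at hi hj
    have h2 := dep_iterate_add hdep (j := i) fun k hk => h k (by omega)
    have h3 := dep_iterate_add hdep (j := j) fun k hk => h k (by omega)
    simp only at hij
    rw [hij] at h2
    omega
  rw [← h1]
  refine card_le_card fun u hu => ?_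
  obtain ⟨i, hi, rfl⟩ := mem_image.1 hu
  rw [h1]
  refine mem_descendants.2 ⟨K - i, ?_⟩
  rw [← Function.iterate_add_apply, Nat.sub_add_cancel (mem_range.1 hi).le]

/-- A rooted tree has a small set `Z` of vertices meeting every short ascending path, such that
all vertices of large degree are in `Z`, and the ascending paths starting in `Z` meet only
in `Z` or after at least two steps outside of `Z`. -/
lemma exists_skeleton {κ : ℝ} (hκ : 0 < κ) : ∃ K : ℕ, ∀ {V : Type} [Fintype V] [DecidableEq V]
    (par : V → V) (dep : V → ℕ) (r : V), par r = r → (∀ v, v ≠ r → dep v = dep (par v) + 1) →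
    K ≤ Fintype.card V → ∃ Z : Finset V, r ∈ Z ∧ #Z ≤ κ * Fintype.card V ∧
      (∀ v ∉ Z, #{u | u ≠ r ∧ par u = v} ≤ K) ∧ (∀ v, ∃ j ≤ 2 * K, par^[j] v ∈ Z) ∧
      (∀ z ∈ Z, par z ∉ Z → par (par z) ∉ Z) ∧
      ∀ v w, v ≠ r → w ≠ r → par v = par w → par v ∉ Z →
        (v ∈ Z ∨ ∃ z ∈ Z, par z = v) → (w ∈ Z ∨ ∃ z ∈ Z, par z = w) → v = w := by
  obtain ⟨K, hK⟩ := exists_nat_gt (12 / κ + 1)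
  have h12 : 0 < 12 / κ := by positivity
  have hK1 : (1 : ℝ) < K := by linarith
  have hK0 : 1 < K := by exact_mod_cast hK1
  have hKκ : 12 < K * κ := by
    rw [← div_lt_iff₀ hκ]; linarith
  refine ⟨K, fun {V} _ _ par dep r hr hdep hV => ?_⟩
  have hiter : ∀ v, ∃ j, par^[j] v = r := by
    intro v
    by_contra! h
    have := dep_iterate_add hdep (v := v) (j := dep v + 1) fun i _ => h i
    omega
  set C := heavy par K with hC
  have hrC : r ∈ C := by
    rw [hC, mem_heavy]
    refine hV.trans (card_le_card fun u _ => mem_descendants.2 (hiter u))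
  obtain ⟨ρ, hρK, hρ⟩ := exists_residue_card_mul_le dep (by omega : 0 < K) C
  set Z₀ : Finset V := {r} ∪ ({v ∈ C | 2 ≤ #(childrenIn par r C v)} ∪
    ({v ∈ C | dep v % K = ρ} ∪ {v ∈ (univ : Finset V) | K ≤ #(childrenIn par r univ v)})) with hZ₀
  have hZ₀C : ∀ z ∈ Z₀, z ∈ C := by
    intro z hz
    simp only [hZ₀, mem_union, mem_singleton, mem_filter, mem_univ, true_and] at hz
    rcases hz with rfl | h | h | h
    · exact hrC
    · exact h.1
    · exact h.1
    · rw [hC, mem_heavy]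
      refine h.trans (card_le_card fun u hu => ?_)
      exact mem_descendants.2 ⟨1, (mem_filter.1 hu).2.2⟩
  set Z : Finset V := Z₀ ∪ {z ∈ Z₀ | par (par z) ∈ Z₀}.image par with hZ
  have hZ₀Z : Z₀ ⊆ Z := subset_union_left
  have hZC : ∀ z ∈ Z, z ∈ C := by
    intro z hz
    rcases mem_union.1 hz with h | h
    · exact hZ₀C z h
    · obtain ⟨w, hw, rfl⟩ := mem_image.1 h
      exact par_mem_heavy (hZ₀C w (mem_filter.1 hw).1)
  have hrZ : r ∈ Z₀ := by simp [hZ₀]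
  have huniq : ∀ v ∈ C, ∀ w ∈ C, v ≠ r → w ≠ r → par v = par w → par v ∉ Z₀ → v = w := by
    intro v hv w hw hvr hwr hvw h
    by_contra hne
    refine h ?_
    have h2 : ({v, w} : Finset V) ⊆ childrenIn par r C (par v) := by
      intro u hu
      rcases mem_insert.1 hu with rfl | hu
      · exact mem_filter.2 ⟨hv, hvr, rfl⟩
      · rw [mem_singleton] at hu
        subst hu
        exact mem_filter.2 ⟨hw, hwr, hvw.symm⟩
    have h3 := card_le_card h2
    rw [card_pair hne] at h3
    simp only [hZ₀, mem_union, mem_filter]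
    exact Or.inr (Or.inl ⟨par_mem_heavy hv, h3⟩)
  have hTC : ∀ v, (v ∈ Z ∨ ∃ z ∈ Z, par z = v) → v ∈ C := by
    rintro v (h | ⟨z, hz, rfl⟩)
    · exact hZC v h
    · exact par_mem_heavy (hZC z hz)
  refine ⟨Z, hZ₀Z hrZ, ?_, ?_, ?_, ?_, ?_⟩
  · have h1 : #Z ≤ #Z₀ + #Z₀ :=
      (card_union_le _ _).trans (Nat.add_le_add_left (card_image_le.trans (card_filter_le _ _)) _)
    have h2 : #Z₀ ≤ 1 + (#{v ∈ C | 2 ≤ #(childrenIn par r C v)} +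
        (#{v ∈ C | dep v % K = ρ} + #{v | K ≤ #(childrenIn par r univ v)})) := by
      refine (card_union_le _ _).trans (Nat.add_le_add (by simp) ?_)
      exact (card_union_le _ _).trans (Nat.add_le_add_left (card_union_le _ _) _)
    have h3 : #{v ∈ C | 2 ≤ #(childrenIn par r C v)} * K ≤ Fintype.card V :=
      card_branching_mul_le hr K
    have h4 := card_many_children_mul_le par r K
    have h5 : #C ≤ Fintype.card V := card_le_univ _
    have h6 : #Z * K ≤ 2 * K + 6 * Fintype.card V := by
      calc #Z * K ≤ (2 * (1 + (#{v ∈ C | 2 ≤ #(childrenIn par r C v)} +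
        (#{v ∈ C | dep v % K = ρ} + #{v | K ≤ #(childrenIn par r univ v)})))) * K :=
            Nat.mul_le_mul_right _ (by omega)
        _ = 2 * K + 2 * (#{v ∈ C | 2 ≤ #(childrenIn par r C v)} * K +
          #{v ∈ C | dep v % K = ρ} * K + #{v | K ≤ #(childrenIn par r univ v)} * K) := by ring
        _ ≤ _ := by omega
    have h7 : #Z * K ≤ 8 * Fintype.card V := by omega
    have h8 : (#Z : ℝ) * K ≤ 8 * Fintype.card V := by exact_mod_cast h7
    have h9 : (0 : ℝ) ≤ Fintype.card V := by positivity
    have h10 : (#Z : ℝ) * K ≤ κ * Fintype.card V * K := by nlinarith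
    exact le_of_mul_le_mul_right h10 (by linarith)
  · intro v hv
    by_contra! h
    refine hv (hZ₀Z ?_)
    simp only [hZ₀, mem_union, mem_filter, mem_univ, true_and]
    exact Or.inr (Or.inr (Or.inr h.le))
  · intro v
    by_contra! h
    have hne : ∀ i ≤ 2 * K, par^[i] v ≠ r := fun i hi h' => h i hi (h' ▸ hZ₀Z hrZ)
    have h1 := iterate_mem_heavy_of_ne hdep (v := v) (K := K) fun i hi => hne i (by omega)
    have h2 := dep_iterate_add hdep (v := v) (j := 2 * K) fun i hi => hne i (by omega)
    -- the depths take every residue among `K` consecutive vertices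
    obtain ⟨i, hi, hmod⟩ : ∃ i < K, (dep v - K - i) % K = ρ := by
      refine ⟨(dep v - K - ρ) % K, Nat.mod_lt _ (by omega), ?_⟩
      have h4 := Nat.div_add_mod (dep v - K - ρ) K
      have h5 : dep v - K - (dep v - K - ρ) % K = ρ + K * ((dep v - K - ρ) / K) := by omega
      rw [h5, Nat.add_mul_mod_self_left, Nat.mod_eq_of_lt hρK]
    refine h (i + K) (by omega) (hZ₀Z ?_)
    have h3 := dep_iterate_add hdep (v := v) (j := i + K) fun k hk => hne k (by omega)
    simp only [hZ₀, mem_union, mem_filter]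
    refine Or.inr (Or.inr (Or.inl ⟨?_, ?_⟩))
    · rw [Function.iterate_add_apply]
      exact iterate_mem_heavy h1 i
    · rw [← hmod]; congr 1; omega
  · intro z hz hpz hppz
    rcases mem_union.1 hz with h | h
    · have hpr : par z ≠ r := fun h' => hpz (h' ▸ hZ₀Z hrZ)
      by_cases h0 : par (par z) ∈ Z₀
      · exact hpz (mem_union_right _ (mem_image_of_mem _ (mem_filter.2 ⟨h, h0⟩)))
      · rcases mem_union.1 hppz with h1 | h1
        · exact h0 h1
        · obtain ⟨w, hw, hw'⟩ := mem_image.1 h1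
          have hwr : w ≠ r := by
            rintro rfl
            rw [hr] at hw'
            exact h0 (hw' ▸ hrZ)
          have hwZ := (mem_filter.1 hw).1
          rw [huniq (par z) (par_mem_heavy (hZC z hz)) w (hZ₀C w hwZ) hpr hwr hw'.symm h0] at hpz
          exact hpz (hZ₀Z hwZ)
    · obtain ⟨w, hw, rfl⟩ := mem_image.1 h
      exact hpz (hZ₀Z (mem_filter.1 hw).2)
  · intro v w hvr hwr hvw hvZ hv hw
    exact huniq v (hTC v hv) w (hTC w hw) hvr hwr hvw fun h => hvZ (hZ₀Z h)

end RootedTree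

section Assembly

variable {V Γ : Type} [Fintype V] [DecidableEq V] [AddCommGroup Γ] [Fintype Γ] [DecidableEq Γ]

/-- The vertices of `P` whose edge to the parent lies inside `P`. -/
def settled (par : V → V) (r : V) (P : Finset V) : Finset V := {v ∈ P | v ≠ r ∧ par v ∈ P}

/-- The label sum of the edge from `v` to its parent. -/
def edgeSum (par : V → V) (f : V → Γ) (v : V) : Γ := f v + f (par v)

/-- Labels outside `X` can be joined through `A` and `B` while avoiding `L` labels and `L` sums. -/
structure IsReserve (A B X : Finset Γ) (L : ℕ) : Prop where
  one : ∀ F G : Finset Γ, #F ≤ L → #G ≤ L → ∀ y ∉ X, ∃ u ∈ A, u ∉ F ∧ u ∉ X ∧ y + u ∈ B ∧ y + u ∉ G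
  two : ∀ F G : Finset Γ, #F ≤ L → #G ≤ L → ∀ y ∉ X, ∀ z ∉ X,
    ∃ u ∈ A, ∃ v ∈ A, u ≠ v ∧ u ∉ F ∧ v ∉ F ∧ u ∉ X ∧ v ∉ X ∧ y + u ∈ B ∧ u + v ∈ B ∧
      z + v ∈ B ∧ y + u ∉ G ∧ u + v ∉ G ∧ z + v ∉ G ∧ y + u ≠ u + v ∧ u + v ≠ z + v ∧
      y + u ≠ z + v

/-- The combinatorial properties of the set `Z` used when labelling the tree around it. -/
structure IsSkeleton (par : V → V) (r : V) (Z : Finset V) : Prop where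
  par_root : par r = r
  root_mem : r ∈ Z
  gap : ∀ z ∈ Z, par z ∉ Z → par (par z) ∉ Z
  inj : ∀ v w, v ≠ r → w ≠ r → par v = par w → par v ∉ Z →
    (v ∈ Z ∨ ∃ z ∈ Z, par z = v) → (w ∈ Z ∨ ∃ z ∈ Z, par z = w) → v = w

/-- `f` is a harmonious labelling of the part of the tree in `P`; the reserves `A`, `B` are only
used at `W`, and among the labels in `U` and sums in `S` only those in `E`, `E'` are used. -/
structure IsPartialLabeling (par : V → V) (r : V) (Z : Finset V) (A B X E E' : Finset Γ)
    (P : Finset V) (f : V → Γ) (W : Finset V) (U S : Finset Γ) : Prop where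
  subset : Z ⊆ P
  par_mem : ∀ v ∈ P, v ∉ Z → par v ∈ P
  connector_mem : ∀ z ∈ Z, par z ∉ Z → par (par z) ∈ P → par z ∈ P
  injOn : Set.InjOn f P
  sum_injOn : Set.InjOn (edgeSum par f) (settled par r P)
  notMem : ∀ v ∈ P, f v ∉ X
  mem_of_label : ∀ v ∈ P, f v ∈ A → v ∈ W
  mem_of_sum : ∀ v ∈ settled par r P, edgeSum par f v ∈ B → v ∈ W
  label_mem : ∀ v ∈ P, f v ∈ U → f v ∈ E
  sum_mem : ∀ v ∈ settled par r P, edgeSum par f v ∈ S → edgeSum par f v ∈ E'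

variable {par : V → V} {r : V} {Z : Finset V} {A B X E E' : Finset Γ} {P : Finset V} {f : V → Γ}
  {W : Finset V} {U S : Finset Γ}

lemma mem_settled {v : V} : v ∈ settled par r P ↔ v ∈ P ∧ v ≠ r ∧ par v ∈ P := mem_filter

lemma IsSkeleton.ne_root (hZ : IsSkeleton par r Z) {v : V} (h : v ∉ Z) : v ≠ r :=
  fun h' => h (h' ▸ hZ.root_mem)

lemma IsSkeleton.ne_root_of_par (hZ : IsSkeleton par r Z) {v : V} (h : par v ∉ Z) : v ≠ r :=
  fun h' => h (h' ▸ hZ.par_root.symm ▸ hZ.root_mem)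

lemma IsPartialLabeling.edgeSum_eq {f' : V → Γ} (hf : ∀ v ∈ P, f' v = f v) {v : V}
    (hv : v ∈ settled par r P) : edgeSum par f' v = edgeSum par f v := by
  obtain ⟨h1, -, h2⟩ := mem_settled.1 hv
  rw [edgeSum, edgeSum, hf v h1, hf _ h2]

lemma IsPartialLabeling.extend (h : IsPartialLabeling par r Z A B X E E' P f W U S)
    {P' : Finset V} {f' : V → Γ} {W' : Finset V} {U' S' : Finset Γ} (hP : P ⊆ P')
    (hf : ∀ v ∈ P, f' v = f v) (hW : W ⊆ W') (hU : U' ⊆ U) (hS : S' ⊆ S)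
    (hpar : ∀ v ∈ P', v ∉ Z → par v ∈ P')
    (hconn : ∀ z ∈ Z, par z ∉ Z → par (par z) ∈ P' → par z ∈ P')
    (hN : ∀ v ∈ P', v ∉ P → (∀ w ∈ P', f' w = f' v → w = v) ∧ f' v ∉ X ∧ (f' v ∈ A → v ∈ W') ∧
      f' v ∉ U')
    (hM : ∀ v ∈ settled par r P', v ∉ settled par r P →
      (∀ w ∈ settled par r P', edgeSum par f' w = edgeSum par f' v → w = v) ∧
      (edgeSum par f' v ∈ B → v ∈ W') ∧ edgeSum par f' v ∉ S') :
    IsPartialLabeling par r Z A B X E E' P' f' W' U' S' where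
  subset := h.subset.trans hP
  par_mem := hpar
  connector_mem := hconn
  injOn := by
    intro v hv w hw hvw
    by_cases h1 : v ∈ P
    · by_cases h2 : w ∈ P
      · exact h.injOn h1 h2 (by rwa [hf v h1, hf w h2] at hvw)
      · exact (hN w hw h2).1 v hv hvw
    · exact ((hN v hv h1).1 w hw hvw.symm).symm
  sum_injOn := by
    intro v hv w hw hvw
    by_cases h1 : v ∈ settled par r P
    · by_cases h2 : w ∈ settled par r P
      · exact h.sum_injOn h1 h2 (by rwa [edgeSum_eq hf h1, edgeSum_eq hf h2] at hvw)
      · exact (hM w hw h2).1 v hv hvw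
    · exact ((hM v hv h1).1 w hw hvw.symm).symm
  notMem v hv := by
    by_cases h1 : v ∈ P
    · rw [hf v h1]; exact h.notMem v h1
    · exact (hN v hv h1).2.1
  mem_of_label v hv hA := by
    by_cases h1 : v ∈ P
    · rw [hf v h1] at hA; exact hW (h.mem_of_label v h1 hA)
    · exact (hN v hv h1).2.2.1 hA
  mem_of_sum v hv hB := by
    by_cases h1 : v ∈ settled par r P
    · rw [edgeSum_eq hf h1] at hB; exact hW (h.mem_of_sum v h1 hB)
    · exact (hM v hv h1).2.1 hB
  label_mem v hv hvU := by
    by_cases h1 : v ∈ P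
    · rw [hf v h1] at hvU ⊢; exact h.label_mem v h1 (hU hvU)
    · exact absurd hvU (hN v hv h1).2.2.2
  sum_mem v hv hvS := by
    by_cases h1 : v ∈ settled par r P
    · rw [edgeSum_eq hf h1] at hvS ⊢; exact h.sum_mem v h1 (hS hvS)
    · exact absurd hvS (hM v hv h1).2.2

/-- Adding vertices which are not close to being parents of vertices of `Z`. -/
lemma IsPartialLabeling.extend_of_single (h : IsPartialLabeling par r Z A B X E E' P f W U S)
    {N : Finset V} {f' : V → Γ} {W' : Finset V} {U' S' : Finset Γ}
    (hf : ∀ v ∈ P, f' v = f v) (hW : W ⊆ W') (hU : U' ⊆ U) (hS : S' ⊆ S)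
    (hNP : ∀ v ∈ N, v ∉ P ∧ par v ∈ P)
    (hNZ : ∀ v ∈ N, ∀ z ∈ Z, par z ≠ v ∧ (par z ∉ Z → par (par z) ≠ v))
    (hinj : Set.InjOn f' N) (hsum : Set.InjOn (edgeSum par f') N)
    (hN : ∀ v ∈ N, (∀ w ∈ P, f w ≠ f' v) ∧ f' v ∉ X ∧ (f' v ∈ A → v ∈ W') ∧
      f' v ∉ U')
    (hM : ∀ v ∈ N, (∀ w ∈ settled par r P, edgeSum par f w ≠ edgeSum par f' v) ∧
      (edgeSum par f' v ∈ B → v ∈ W') ∧ edgeSum par f' v ∉ S') :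
    IsPartialLabeling par r Z A B X E E' (P ∪ N) f' W' U' S' := by
  have hnew : ∀ v ∈ settled par r (P ∪ N), v ∉ settled par r P → v ∈ N := by
    intro v hv hv'
    rw [mem_settled] at hv hv'
    by_contra hvN
    have hvP : v ∈ P := by simpa [hvN] using hv.1
    by_cases hvZ : v ∈ Z
    · have hpN : par v ∈ N := by
        have := hv.2.2
        rw [mem_union] at this
        exact this.resolve_left fun h' => hv' ⟨hvP, hv.2.1, h'⟩
      exact (hNZ _ hpN v hvZ).1 rfl
    · exact hv' ⟨hvP, hv.2.1, h.par_mem v hvP hvZ⟩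
  refine h.extend subset_union_left hf hW hU hS ?_ ?_ ?_ ?_
  · intro v hv hvZ
    rcases mem_union.1 hv with h1 | h1
    · exact mem_union_left _ (h.par_mem v h1 hvZ)
    · exact mem_union_left _ (hNP v h1).2
  · intro z hz hpz hppz
    rcases mem_union.1 hppz with h1 | h1
    · exact mem_union_left _ (h.connector_mem z hz hpz h1)
    · exact absurd rfl ((hNZ _ h1 z hz).2 hpz)
  · intro v hv hvP
    have hvN : v ∈ N := (mem_union.1 hv).resolve_left hvP
    obtain ⟨h1, h2⟩ := hN v hvN
    refine ⟨fun w hw hwv => ?_, h2⟩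
    by_cases hwP : w ∈ P
    · exact absurd (hf w hwP ▸ hwv) (h1 w hwP)
    · exact hinj ((mem_union.1 hw).resolve_left hwP) hvN hwv
  · intro v hv hv'
    have hvN := hnew v hv hv'
    obtain ⟨h1, h2⟩ := hM v hvN
    refine ⟨fun w hw hwv => ?_, h2⟩
    by_cases hw' : w ∈ settled par r P
    · exact absurd (edgeSum_eq hf hw' ▸ hwv) (h1 w hw')
    · exact hsum (hnew w hw hw') hvN hwv

lemma IsPartialLabeling.exists_insert (h : IsPartialLabeling par r Z A B X E E' P f W U S)
    {L : ℕ} (hR : IsReserve A B X L) (hAU : Disjoint A U) (hBS : Disjoint B S) (hW : #W ≤ L)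
    {v : V} (hv : v ∉ P) (hpv : par v ∈ P)
    (hvZ : ∀ z ∈ Z, par z ≠ v ∧ (par z ∉ Z → par (par z) ≠ v)) :
    ∃ f' : V → Γ, (∀ v ∈ P, f' v = f v) ∧
      IsPartialLabeling par r Z A B X E E' (P ∪ {v}) f' (insert v W) U S := by
  obtain ⟨u, huA, huF, huX, huB, huG⟩ := hR.one (W.image f) (W.image (edgeSum par f))
    (card_image_le.trans hW) (card_image_le.trans hW) _ (h.notMem _ hpv)
  have hf : ∀ w ∈ P, Function.update f v u w = f w := fun w hw =>
    Function.update_of_ne (fun h' : w = v => hv (h' ▸ hw)) _ _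
  have hs : edgeSum par (Function.update f v u) v = f (par v) + u := by
    rw [edgeSum, hf _ hpv, Function.update_self, add_comm]
  refine ⟨Function.update f v u, hf, h.extend_of_single hf (subset_insert _ _) le_rfl le_rfl
    ?_ ?_ ?_ ?_ ?_ ?_⟩
  · intro w hw
    rw [mem_singleton] at hw
    subst hw
    exact ⟨hv, hpv⟩
  · intro w hw
    rw [mem_singleton] at hw
    subst hw
    exact hvZ
  · simp
  · simp
  · intro w hw
    rw [mem_singleton] at hw
    subst hw
    rw [Function.update_self]
    refine ⟨fun w hw hwu => huF (mem_image.2 ⟨w, h.mem_of_label w hw (hwu ▸ huA), hwu⟩), huX,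
      fun _ => mem_insert_self _ _, disjoint_left.1 hAU huA⟩
  · intro w hw
    rw [mem_singleton] at hw
    subst hw
    rw [hs]
    refine ⟨fun w hw hwu => huG (mem_image.2 ⟨w, h.mem_of_sum w hw (hwu ▸ huB), hwu⟩),
      fun _ => mem_insert_self _ _, disjoint_left.1 hBS huB⟩

lemma IsPartialLabeling.exists_insert_pair (hZ : IsSkeleton par r Z)
    (h : IsPartialLabeling par r Z A B X E E' P f W U S)
    {L : ℕ} (hR : IsReserve A B X L) (hAU : Disjoint A U) (hBS : Disjoint B S) (hW : #W ≤ L)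
    {z : V} (hz : z ∈ Z) (hpz : par z ∉ Z) (hppz : par (par z) ∉ P)
    (hpppz : par (par (par z)) ∈ P) (hWz : z ∈ W ∧ par z ∈ W ∧ par (par z) ∈ W) :
    ∃ f' : V → Γ, (∀ v ∈ P, f' v = f v) ∧
      IsPartialLabeling par r Z A B X E E' (P ∪ {par z, par (par z)}) f' W U S := by
  have hzP : z ∈ P := h.subset hz
  have hpzP : par z ∉ P := fun h' => hppz (h.par_mem _ h' hpz)
  obtain ⟨u, huA, v, hvA, huv, huF, hvF, huX, hvX, huB, huvB, hvB, huG, huvG, hvG, hs1, hs2, hs3⟩ :=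
    hR.two (W.image f) (W.image (edgeSum par f))
    (card_image_le.trans hW) (card_image_le.trans hW) _ (h.notMem _ hpppz) _ (h.notMem _ hzP)
  have hzr := hZ.ne_root_of_par hpz
  have hzr' := hZ.ne_root hpz
  have hppZ : par (par z) ∉ Z := fun h' => hppz (h.subset h')
  have hne : par (par z) ≠ par z := by
    intro heq
    have := hZ.inj (par z) z hzr' hzr heq hppZ (Or.inr ⟨z, hz, rfl⟩) (Or.inl hz)
    exact hpz (by rwa [this])
  set f' := Function.update (Function.update f (par z) v) (par (par z)) u with hf'
  have hfz : f' (par z) = v := by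
    rw [hf', Function.update_of_ne hne.symm, Function.update_self]
  have hfz' : f' (par (par z)) = u := Function.update_self _ _ _
  have hf : ∀ w ∈ P, f' w = f w := fun w hw => by
    rw [hf', Function.update_of_ne (fun h' : w = par (par z) => hppz (h' ▸ hw)),
      Function.update_of_ne (fun h' : w = par z => hpzP (h' ▸ hw))]
  have hσ1 : edgeSum par f' (par (par z)) = f (par (par (par z))) + u := by
    rw [edgeSum, hfz', hf _ hpppz, add_comm]
  have hσ2 : edgeSum par f' (par z) = u + v := by
    rw [edgeSum, hfz', hfz, add_comm]
  have hσ3 : edgeSum par f' z = f z + v := by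
    rw [edgeSum, hfz, hf _ hzP]
  have hnew : ∀ w ∈ settled par r (P ∪ {par z, par (par z)}), w ∉ settled par r P →
      w = par (par z) ∨ w = par z ∨ w = z := by
    intro w hw hw'
    simp only [mem_settled, mem_union, mem_insert, mem_singleton] at hw hw'
    rcases hw.1 with hwP | rfl | rfl
    · have hpw : par w ∉ P := fun h' => hw' ⟨hwP, hw.2.1, h'⟩
      have hwZ : w ∈ Z := by
        by_contra h'
        exact hpw (h.par_mem w hwP h')
      rcases hw.2.2 with h1 | h1 | h1
      · exact absurd h1 hpw
      · exact Or.inr (Or.inr (hZ.inj w z hw.2.1 hzr h1 (h1 ▸ hpz) (Or.inl hwZ) (Or.inl hz)))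
      · have := hZ.inj w (par z) hw.2.1 hzr' h1 (h1 ▸ hppZ) (Or.inl hwZ) (Or.inr ⟨z, hz, rfl⟩)
        exact absurd (this ▸ hwZ) hpz
    · exact Or.inr (Or.inl rfl)
    · exact Or.inl rfl
  have hold : ∀ w ∈ settled par r P, ∀ s ∈ B, s ∉ W.image (edgeSum par f) →
      edgeSum par f' w ≠ s := by
    intro w hw s hsB hsG hws
    rw [edgeSum_eq hf hw] at hws
    exact hsG (mem_image.2 ⟨w, h.mem_of_sum w hw (hws ▸ hsB), hws⟩)
  have holdl : ∀ w ∈ P, ∀ s ∈ A, s ∉ W.image f → f' w ≠ s := by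
    intro w hw s hsA hsF hws
    rw [hf w hw] at hws
    exact hsF (mem_image.2 ⟨w, h.mem_of_label w hw (hws ▸ hsA), hws⟩)
  refine ⟨f', hf, h.extend subset_union_left hf le_rfl le_rfl le_rfl ?_ ?_ ?_ ?_⟩
  · intro w hw hwZ
    simp only [mem_union, mem_insert, mem_singleton] at hw ⊢
    rcases hw with h1 | rfl | rfl
    · exact Or.inl (h.par_mem w h1 hwZ)
    · exact Or.inr (Or.inr rfl)
    · exact Or.inl hpppz
  · intro y hy hpy hppy
    simp only [mem_union, mem_insert, mem_singleton] at hppy ⊢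
    rcases hppy with h1 | h1 | h1
    · exact Or.inl (h.connector_mem y hy hpy h1)
    · have := hZ.inj (par y) z (hZ.ne_root hpy) hzr h1 (h1 ▸ hpz) (Or.inr ⟨y, hy, rfl⟩) (Or.inl hz)
      exact absurd (this ▸ hz) hpy
    · exact Or.inr (Or.inl (hZ.inj (par y) (par z) (hZ.ne_root hpy) hzr' h1 (h1 ▸ hppZ)
        (Or.inr ⟨y, hy, rfl⟩) (Or.inr ⟨z, hz, rfl⟩)))
  · intro w hw hwP
    simp only [mem_union, mem_insert, mem_singleton] at hw
    rcases hw.resolve_left hwP with rfl | rfl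
    · rw [hfz]
      refine ⟨fun y hy hyv => ?_, hvX, fun _ => hWz.2.1, disjoint_left.1 hAU hvA⟩
      simp only [mem_union, mem_insert, mem_singleton] at hy
      rcases hy with h1 | rfl | rfl
      · exact absurd hyv (holdl y h1 v hvA hvF)
      · rfl
      · exact absurd (hfz'.symm.trans hyv) huv
    · rw [hfz']
      refine ⟨fun y hy hyv => ?_, huX, fun _ => hWz.2.2, disjoint_left.1 hAU huA⟩
      simp only [mem_union, mem_insert, mem_singleton] at hy
      rcases hy with h1 | rfl | rfl
      · exact absurd hyv (holdl y h1 u huA huF)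
      · exact absurd (hfz.symm.trans hyv).symm huv
      · rfl
  · intro w hw hw'
    rcases hnew w hw hw' with rfl | rfl | rfl
    · rw [hσ1]
      refine ⟨fun y hy hyv => ?_, fun _ => hWz.2.2, disjoint_left.1 hBS huB⟩
      by_cases hy' : y ∈ settled par r P
      · exact absurd hyv (hold y hy' _ huB huG)
      rcases hnew y hy hy' with rfl | rfl | rfl
      · rfl
      · exact absurd (hσ2.symm.trans hyv).symm hs1
      · exact absurd (hσ3.symm.trans hyv).symm hs3
    · rw [hσ2]
      refine ⟨fun y hy hyv => ?_, fun _ => hWz.2.1, disjoint_left.1 hBS huvB⟩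
      by_cases hy' : y ∈ settled par r P
      · exact absurd hyv (hold y hy' _ huvB huvG)
      rcases hnew y hy hy' with rfl | rfl | rfl
      · exact absurd (hσ1.symm.trans hyv) hs1
      · rfl
      · exact absurd (hσ3.symm.trans hyv).symm hs2
    · rw [hσ3]
      refine ⟨fun y hy hyv => ?_, fun _ => hWz.1, disjoint_left.1 hBS hvB⟩
      by_cases hy' : y ∈ settled par r P
      · exact absurd hyv (hold y hy' _ hvB hvG)
      rcases hnew y hy hy' with rfl | rfl | rfl
      · exact absurd (hσ1.symm.trans hyv) hs3
      · exact absurd (hσ2.symm.trans hyv) hs2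
      · rfl

/-- All vertices of `R`, whose parents are labelled, can be labelled through the reserves. -/
lemma IsPartialLabeling.exists_cleanup (hZ : IsSkeleton par r Z)
    (h : IsPartialLabeling par r Z A B X E E' P f W U S)
    {L : ℕ} (hR : IsReserve A B X L) (hAU : Disjoint A U) (hBS : Disjoint B S)
    (hWZ : ∀ z ∈ Z, z ∈ W ∧ par z ∈ W ∧ par (par z) ∈ W) (R : Finset V) (hRP : ∀ v ∈ R, par v ∈ P)
    (hW : #W + #{v ∈ R | v ∉ P ∧ ∀ z ∈ Z, par z ≠ v ∧ (par z ∉ Z → par (par z) ≠ v)} ≤ L) :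
    ∃ (P' : Finset V) (f' : V → Γ) (W' : Finset V), P ⊆ P' ∧ R ⊆ P' ∧ (∀ v ∈ P, f' v = f v) ∧
      W ⊆ W' ∧
      #W' ≤ #W + #{v ∈ R | v ∉ P ∧ ∀ z ∈ Z, par z ≠ v ∧ (par z ∉ Z → par (par z) ≠ v)} ∧
      IsPartialLabeling par r Z A B X E E' P' f' W' U S := by
  induction R using Finset.induction_on with
  | empty => exact ⟨P, f, W, le_rfl, empty_subset _, fun _ _ => rfl, le_rfl, by simp, h⟩
  | insert v R hvR ih =>
    have hmono : #{v ∈ R | v ∉ P ∧ ∀ z ∈ Z, par z ≠ v ∧ (par z ∉ Z → par (par z) ≠ v)} ≤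
        #{v ∈ insert v R | v ∉ P ∧ ∀ z ∈ Z, par z ≠ v ∧ (par z ∉ Z → par (par z) ≠ v)} :=
      card_le_card (filter_subset_filter _ (subset_insert _ _))
    obtain ⟨P', f', W', hPP, hRP', hff, hWW, hWc, h'⟩ :=
      ih (fun w hw => hRP w (mem_insert_of_mem hw)) (by omega)
    by_cases hv : v ∈ P'
    · exact ⟨P', f', W', hPP, insert_subset hv hRP', hff, hWW, by omega, h'⟩
    have hpv : par v ∈ P' := hPP (hRP v (mem_insert_self _ _))
    by_cases hs : ∀ z ∈ Z, par z ≠ v ∧ (par z ∉ Z → par (par z) ≠ v)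
    · have hc : #{w ∈ insert v R | w ∉ P ∧ ∀ z ∈ Z, par z ≠ w ∧ (par z ∉ Z → par (par z) ≠ w)} =
          #{w ∈ R | w ∉ P ∧ ∀ z ∈ Z, par z ≠ w ∧ (par z ∉ Z → par (par z) ≠ w)} + 1 := by
        rw [filter_insert, if_pos ⟨fun h => hv (hPP h), hs⟩, card_insert_of_notMem]
        exact fun hm => hvR (mem_filter.1 hm).1
      obtain ⟨f'', hff', h''⟩ := h'.exists_insert hR hAU hBS (by omega) hv hpv hs
      refine ⟨P' ∪ {v}, f'', insert v W', hPP.trans subset_union_left, ?_, fun w hw => ?_,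
        hWW.trans (subset_insert _ _), ?_, h''⟩
      · exact insert_subset (by simp) (hRP'.trans subset_union_left)
      · rw [hff' w (hPP hw), hff w hw]
      · exact (card_insert_le _ _).trans (by omega)
    · push Not at hs
      obtain ⟨z, hz, hzv⟩ := hs
      have hpz : par z ≠ v := by
        rintro rfl
        refine hv (h'.connector_mem z hz (fun hpz => hv (h'.subset hpz)) hpv)
      obtain ⟨hpZ, rfl⟩ := hzv hpz
      obtain ⟨f'', hff', h''⟩ := h'.exists_insert_pair hZ hR hAU hBS (by omega) hz hpZ hv hpv
        ⟨hWW (hWZ z hz).1, hWW (hWZ z hz).2.1, hWW (hWZ z hz).2.2⟩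
      refine ⟨_, f'', W', hPP.trans subset_union_left, ?_, fun w hw => ?_, hWW, by omega, h''⟩
      · exact insert_subset (by simp) (hRP'.trans subset_union_left)
      · rw [hff' w (hPP hw), hff w hw]

end Assembly

section Layers

variable {V Γ : Type} [Fintype V] [DecidableEq V] [AddCommGroup Γ] [Fintype Γ] [DecidableEq Γ]

/-- The vertices which can be labelled next, apart from the connectors between vertices of `Z`. -/
def nextLayer (par : V → V) (Z P : Finset V) : Finset V :=
  {v | par v ∈ P ∧ v ∉ P ∧ ∀ z ∈ Z, par z ≠ v ∧ (par z ∉ Z → par (par z) ≠ v)}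

variable {par : V → V} {r : V} {Z : Finset V} {A B X E E' : Finset Γ} {P : Finset V} {f : V → Γ}
  {W : Finset V} {U S : Finset Γ}

lemma IsPartialLabeling.exists_stage (hZ : IsSkeleton par r Z)
    (h : IsPartialLabeling par r Z A B X E E' P f W U S)
    {L : ℕ} (hR : IsReserve A B X L) (hXE : X ⊆ E)
    (hWZ : ∀ z ∈ Z, z ∈ W ∧ par z ∈ W ∧ par (par z) ∈ W)
    {U' S' : Finset Γ} (hU : U' ⊆ U) (hS : S' ⊆ S) (hAU : Disjoint A U') (hBS : Disjoint B S')
    {I' : Finset V} (hI' : I' ⊆ nextLayer par Z P) {w : V → Γ} (hw : Set.InjOn w I')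
    (hs : Set.InjOn (fun i => f (par i) + w i) I')
    (hwU : ∀ i ∈ I', w i ∉ A ∧ w i ∉ U' ∧ f (par i) + w i ∉ B ∧ f (par i) + w i ∉ S')
    (hwf : ∀ i ∈ I', ∀ v ∈ P, f v = w i → w i ∈ E)
    (hsf : ∀ i ∈ I', ∀ v ∈ settled par r P, edgeSum par f v = f (par i) + w i →
      f (par i) + w i ∈ E')
    (hL : #W + (#(nextLayer par Z P \ I') + #{i ∈ I' | w i ∈ E} +
      #{i ∈ I' | f (par i) + w i ∈ E'}) ≤ L) :
    ∃ (P' : Finset V) (f' : V → Γ) (W' : Finset V), P ⊆ P' ∧ (∀ v, par v ∈ P → v ∈ P') ∧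
      W ⊆ W' ∧
      #W' ≤ #W + (#(nextLayer par Z P \ I') + #{i ∈ I' | w i ∈ E} +
        #{i ∈ I' | f (par i) + w i ∈ E'}) ∧
      IsPartialLabeling par r Z A B X E E' P' f' W' U' S' := by
  set J := {i ∈ I' | w i ∉ E ∧ f (par i) + w i ∉ E'} with hJ
  have hJI : J ⊆ I' := filter_subset _ _
  have hJF : ∀ i ∈ J, par i ∈ P ∧ i ∉ P ∧ ∀ z ∈ Z, par z ≠ i ∧ (par z ∉ Z → par (par z) ≠ i) :=
    fun i hi => (mem_filter.1 (hI' (hJI hi))).2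
  have hJP : ∀ v ∈ P, v ∉ J := fun v hv hvJ => (hJF v hvJ).2.1 hv
  set f' : V → Γ := fun v => if v ∈ J then w v else f v with hf'
  have hff : ∀ v ∈ P, f' v = f v := fun v hv => if_neg (hJP v hv)
  have hfw : ∀ v ∈ J, f' v = w v := fun v hv => if_pos hv
  have hsw : ∀ v ∈ J, edgeSum par f' v = f (par v) + w v := fun v hv => by
    rw [edgeSum, hfw v hv, hff _ (hJF v hv).1, add_comm]
  have h1 : IsPartialLabeling par r Z A B X E E' (P ∪ J) f' W U' S' := by
    refine h.extend_of_single hff le_rfl hU hS (fun v hv => ⟨(hJF v hv).2.1, (hJF v hv).1⟩)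
      (fun v hv => (hJF v hv).2.2) ?_ ?_ ?_ ?_
    · intro v hv v' hv' hvv
      rw [hfw v hv, hfw v' hv'] at hvv
      exact hw (hJI hv) (hJI hv') hvv
    · intro v hv v' hv' hvv
      rw [hsw v hv, hsw v' hv'] at hvv
      exact hs (hJI hv) (hJI hv') hvv
    · intro v hv
      obtain ⟨hv1, hv2, hv3⟩ := mem_filter.1 hv
      obtain ⟨a1, a2, a3, a4⟩ := hwU v hv1
      rw [hfw v hv]
      exact ⟨fun y hy hyv => hv2 (hwf v hv1 y hy hyv), fun hX => hv2 (hXE hX),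
        fun hA => absurd hA a1, a2⟩
    · intro v hv
      obtain ⟨hv1, hv2, hv3⟩ := mem_filter.1 hv
      obtain ⟨a1, a2, a3, a4⟩ := hwU v hv1
      rw [hsw v hv]
      exact ⟨fun y hy hyv => hv3 (hsf v hv1 y hy hyv), fun hB => absurd hB a3, a4⟩
  have hcount : #{v ∈ ({v | par v ∈ P} : Finset V) | v ∉ P ∪ J ∧
      ∀ z ∈ Z, par z ≠ v ∧ (par z ∉ Z → par (par z) ≠ v)} ≤
      #(nextLayer par Z P \ I') + #{i ∈ I' | w i ∈ E} + #{i ∈ I' | f (par i) + w i ∈ E'} := by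
    refine le_trans (card_le_card (t := (nextLayer par Z P \ I') ∪ {i ∈ I' | w i ∈ E} ∪
      {i ∈ I' | f (par i) + w i ∈ E'}) fun v hv => ?_) ((card_union_le _ _).trans
        (Nat.add_le_add_right (card_union_le _ _) _))
    simp only [mem_filter, mem_univ, true_and, mem_union, not_or, hJ, nextLayer, mem_sdiff] at hv ⊢
    tauto
  obtain ⟨P', f'', W', hPP, hRP, -, hWW, hWc, h2⟩ := h1.exists_cleanup hZ hR hAU hBS hWZ
    ({v | par v ∈ P}) (fun v hv => mem_union_left _ (mem_filter.1 hv).2) (by omega)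
  exact ⟨P', f'', W', subset_union_left.trans hPP, fun v hv => hRP (by simpa using hv), hWW,
    by omega, h2⟩

lemma card_filter_add_card_inter_le {I : Finset V} {w : V → Γ} (hw : Set.InjOn w I)
    {U : Finset Γ} (hU : ∀ i ∈ I, w i ∈ U) (E : Finset Γ) :
    #{i ∈ I | w i ∈ E} + #(E ∩ (U \ I.image w)) ≤ #(E ∩ U) := by
  have h1 : #({i ∈ I | w i ∈ E}.image w) = #{i ∈ I | w i ∈ E} :=
    card_image_of_injOn (hw.mono (coe_subset.2 (filter_subset _ _)))
  rw [← h1, ← card_union_of_disjoint]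
  · refine card_le_card fun u hu => ?_
    rcases mem_union.1 hu with h | h
    · obtain ⟨i, hi, rfl⟩ := mem_image.1 h
      exact mem_inter.2 ⟨(mem_filter.1 hi).2, hU i (mem_filter.1 hi).1⟩
    · exact mem_inter.2 ⟨(mem_inter.1 h).1, (mem_sdiff.1 (mem_inter.1 h).2).1⟩
  · refine disjoint_left.2 fun u hu hu' => ?_
    refine (mem_sdiff.1 (mem_inter.1 hu').2).2 ?_
    exact image_subset_image (filter_subset _ _) hu

lemma card_sdiff_image_add {I : Finset V} {w : V → Γ} (hw : Set.InjOn w I)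
    {U : Finset Γ} (hU : ∀ i ∈ I, w i ∈ U) : #(U \ I.image w) + #I = #U := by
  have h : I.image w ⊆ U := fun u hu => by
    obtain ⟨i, hi, rfl⟩ := mem_image.1 hu
    exact hU i hi
  rw [card_sdiff_of_subset h, card_image_of_injOn hw]
  exact Nat.sub_add_cancel (card_image_of_injOn hw ▸ card_le_card h)

/-- Starting from pseudorandom sets of unused labels and sums, the labelling can be extended layer
by layer. -/
lemma IsPartialLabeling.exists_layers (hZ : IsSkeleton par r Z)
    (h : IsPartialLabeling par r Z A B X E E' P f W U S)
    {L : ℕ} (hR : IsReserve A B X L) (hXE : X ⊆ E) (hAU : Disjoint A U) (hBS : Disjoint B S)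
    (hWZ : ∀ z ∈ Z, z ∈ W ∧ par z ∈ W ∧ par (par z) ∈ W) (hZP : ∀ v, par v ∈ Z → v ∈ P)
    {Δ ρ θ η p C Φ₀ : ℝ} (hΔ : 1 ≤ Δ) (hp : 0 < p)
    (hρ : 0 ≤ ρ) (hθ : 0 ≤ θ) (hpp : 2 * p = ρ ^ 2 * θ)
    (hΔη : Δ * η ≤ p ^ 4) (hC : C = 8 * Δ / p) (hΦ₀ : 0 ≤ Φ₀)
    (hK : energyBound C (Fintype.card Γ) Φ₀ (Fintype.card V) ≤ η * Fintype.card Γ ^ 3)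
    (hdeg : ∀ v ∉ Z, (#{u | u ≠ r ∧ par u = v} : ℝ) ≤ Δ)
    (hVΓ : Fintype.card V ≤ Fintype.card Γ)
    (hUc : ρ * Fintype.card Γ + #Pᶜ ≤ #U) (hSc : ρ * Fintype.card Γ + #Pᶜ ≤ #S)
    (hE : energy (bal U) + energy (bal S) ≤ Φ₀) {J : ℕ}
    (hL : #W + #(E ∩ U) + #(E' ∩ S) + J * (θ * Fintype.card Γ) ≤ L) {j : ℕ} (hj : j ≤ J) :
    ∃ (P' : Finset V) (f' : V → Γ) (W' : Finset V) (U' S' : Finset Γ) (k : ℕ),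
      IsPartialLabeling par r Z A B X E E' P' f' W' U' S' ∧ P ⊆ P' ∧ W ⊆ W' ∧ U' ⊆ U ∧ S' ⊆ S ∧
      k + #P'ᶜ ≤ Fintype.card V ∧
      energy (bal U') + energy (bal S') ≤ energyBound C (Fintype.card Γ) Φ₀ k ∧
      ρ * Fintype.card Γ + #P'ᶜ ≤ #U' ∧ ρ * Fintype.card Γ + #P'ᶜ ≤ #S' ∧
      #W' + #(E ∩ U') + #(E' ∩ S') ≤
        #W + #(E ∩ U) + #(E' ∩ S) + j * (θ * Fintype.card Γ) ∧
      ∀ v, ∀ i ≤ j, par^[i] v ∈ Z → v ∈ P' := by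
  induction j with
  | zero =>
    refine ⟨P, f, W, U, S, 0, h, le_rfl, le_rfl, le_rfl, le_rfl, ?_, ?_, hUc, hSc, by simp, ?_⟩
    · simpa using card_le_univ _
    · simpa [energyBound] using hE
    · intro v i hi hv
      obtain rfl : i = 0 := by omega
      exact h.subset hv
  | succ j ih =>
    obtain ⟨P₁, f₁, W₁, U₁, S₁, k, h₁, hPP, hWW, hUU, hSS, hk, hE₁, hU₁, hS₁, hpot, hreach⟩ :=
      ih (by omega)
    have hFP : nextLayer par Z P₁ ⊆ P₁ᶜ := fun v hv => mem_compl.2 (mem_filter.1 hv).2.2.1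
    have hFc : #(nextLayer par Z P₁) ≤ #P₁ᶜ := card_le_card hFP
    have hFc' : (#(nextLayer par Z P₁) : ℝ) ≤ #P₁ᶜ := by exact_mod_cast hFc
    have hPc : #P₁ᶜ ≤ Fintype.card V := card_le_univ _
    obtain ⟨I', hI', hfail, w, hw, hs, hwU, hE₂⟩ := exists_layer hΔ hp hρ hθ hpp hΔη hC hΦ₀ hK
      (fun i => f₁ (par i)) _ (nextLayer par Z P₁) U₁ S₁ k rfl (by
        intro y
        rcases eq_empty_or_nonempty {i ∈ nextLayer par Z P₁ | f₁ (par i) = y} with h0 | ⟨a, ha⟩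
        · rw [h0]; simp; linarith
        obtain ⟨ha1, rfl⟩ := mem_filter.1 ha
        obtain ⟨-, ha2, ha3, -⟩ := mem_filter.1 ha1
        have haZ : par a ∉ Z := fun h' => ha3 (hPP (hZP a h'))
        refine le_trans (Nat.cast_le.2 (card_le_card fun b hb => ?_)) (hdeg _ haZ)
        obtain ⟨hb1, hb2⟩ := mem_filter.1 hb
        obtain ⟨-, hb3, hb4, -⟩ := mem_filter.1 hb1
        have hab := h₁.injOn hb3 ha2 hb2
        simp only [mem_filter, mem_univ, true_and]
        exact ⟨hZ.ne_root_of_par (hab ▸ haZ), hab⟩)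
      (by exact_mod_cast hFc.trans (hPc.trans hVΓ)) (by linarith) (by linarith) (by omega) hE₁
    have hf1 := card_filter_add_card_inter_le hw (fun i hi => (hwU i hi).1) E
    have hf2 := card_filter_add_card_inter_le hs (fun i hi => (hwU i hi).2) E'
    have hjJ : ((j + 1 : ℕ) : ℝ) * (θ * Fintype.card Γ) ≤ J * (θ * Fintype.card Γ) := by
      have : ((j + 1 : ℕ) : ℝ) ≤ J := by exact_mod_cast hj
      gcongr
    push_cast at hjJ
    have hf1' : (#{i ∈ I' | w i ∈ E} + #(E ∩ (U₁ \ I'.image w)) : ℝ) ≤ #(E ∩ U₁) := by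
      exact_mod_cast hf1
    have hf2' : (#{i ∈ I' | f₁ (par i) + w i ∈ E'} +
        #(E' ∩ (S₁ \ I'.image fun i => f₁ (par i) + w i)) : ℝ) ≤ #(E' ∩ S₁) := by
      exact_mod_cast hf2
    have hn1 : (0 : ℝ) ≤ #(E ∩ (U₁ \ I'.image w)) := by positivity
    have hn2 : (0 : ℝ) ≤ #(E' ∩ (S₁ \ I'.image fun i => f₁ (par i) + w i)) := by positivity
    obtain ⟨P₂, f₂, W₂, hPP', hreach', hWW', hWc, h₂⟩ := h₁.exists_stage hZ hR hXE
      (fun z hz => ⟨hWW (hWZ z hz).1, hWW (hWZ z hz).2.1, hWW (hWZ z hz).2.2⟩)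
      (U' := U₁ \ I'.image w) (S' := S₁ \ I'.image fun i => f₁ (par i) + w i)
      sdiff_subset sdiff_subset (hAU.mono_right (sdiff_subset.trans hUU))
      (hBS.mono_right (sdiff_subset.trans hSS)) hI' hw hs
      (fun i hi => ⟨disjoint_right.1 hAU (hUU (hwU i hi).1),
        fun h' => (mem_sdiff.1 h').2 (mem_image_of_mem _ hi),
        disjoint_right.1 hBS (hSS (hwU i hi).2),
        fun h' => (mem_sdiff.1 h').2 (mem_image_of_mem _ hi)⟩)
      (fun i hi v hv hvi => hvi ▸ h₁.label_mem v hv (hvi ▸ (hwU i hi).1))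
      (fun i hi v hv hvi => hvi ▸ h₁.sum_mem v hv (hvi ▸ (hwU i hi).2)) (by
        have : (#W₁ + (#(nextLayer par Z P₁ \ I') + #{i ∈ I' | w i ∈ E} +
            #{i ∈ I' | f₁ (par i) + w i ∈ E'}) : ℝ) ≤ L := by linarith
        exact_mod_cast this)
    have hWc' : (#W₂ : ℝ) ≤ #W₁ + (#(nextLayer par Z P₁ \ I') + #{i ∈ I' | w i ∈ E} +
            #{i ∈ I' | f₁ (par i) + w i ∈ E'}) := by exact_mod_cast hWc
    have hP₂ : #P₂ᶜ + #(nextLayer par Z P₁) ≤ #P₁ᶜ := by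
      rw [← card_union_of_disjoint]
      · refine card_le_card (union_subset (compl_subset_compl.2 hPP') hFP)
      · refine disjoint_left.2 fun v hv hv' => ?_
        exact mem_compl.1 hv (hreach' v (mem_filter.1 hv').2.1)
    have hP₂' : (#P₂ᶜ + #(nextLayer par Z P₁) : ℝ) ≤ #P₁ᶜ := by exact_mod_cast hP₂
    have hI'c : (#I' : ℝ) ≤ #(nextLayer par Z P₁) := by exact_mod_cast card_le_card hI'
    have hU₂ : (#(U₁ \ I'.image w) + #I' : ℝ) = #U₁ := by
      exact_mod_cast card_sdiff_image_add hw fun i hi => (hwU i hi).1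
    have hS₂ : (#(S₁ \ I'.image fun i => f₁ (par i) + w i) + #I' : ℝ) = #S₁ := by
      exact_mod_cast card_sdiff_image_add hs fun i hi => (hwU i hi).2
    refine ⟨P₂, f₂, W₂, _, _, k + #(nextLayer par Z P₁), h₂, hPP.trans hPP', hWW.trans hWW',
      sdiff_subset.trans hUU, sdiff_subset.trans hSS, by omega, hE₂, by linarith, by linarith, ?_,
      ?_⟩
    · push_cast
      linarith
    · intro v i hi hv
      rcases Nat.lt_or_ge j i with hij | hij
      · obtain rfl : i = j + 1 := by omega
        rw [Function.iterate_succ_apply] at hv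
        exact hreach' v (hreach _ j le_rfl hv)
      · exact hPP' (hreach v i hij hv)

end Layers

section Main

variable {V Γ : Type} [Fintype V] [DecidableEq V] [AddCommGroup Γ] [Fintype Γ] [DecidableEq Γ]

lemma exists_greedy_labeling {par : V → V} {dep : V → ℕ} {r : V}
    (hdep : ∀ v, v ≠ r → dep v = dep (par v) + 1) (Z : Finset V) (hZ : 2 * #Z ≤ Fintype.card Γ) :
    ∃ f : V → Γ, Set.InjOn f Z ∧ Set.InjOn (edgeSum par f) (settled par r Z) := by
  induction Z using Finset.induction_on_max_value dep with
  | empty => exact ⟨fun _ => 0, by simp, by simp [settled]⟩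
  | insert a s ha hmax ih =>
    rw [card_insert_of_notMem ha] at hZ
    obtain ⟨f, hf, hs⟩ := ih (by omega)
    have hset : ∀ w ∈ settled par r (insert a s), w ∈ settled par r s ∨ w = a ∧ par a ∈ s := by
      intro w hw
      obtain ⟨h1, h2, h3⟩ := mem_settled.1 hw
      have hd := hdep w h2
      rcases mem_insert.1 h1 with rfl | h1
      · rcases mem_insert.1 h3 with h3 | h3
        · rw [h3] at hd; omega
        · exact Or.inr ⟨rfl, h3⟩
      · rcases mem_insert.1 h3 with h3 | h3
        · have := hmax w h1
          rw [h3] at hd; omega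
        · exact Or.inl (mem_settled.2 ⟨h1, h2, h3⟩)
    obtain ⟨u, -, hu⟩ := exists_mem_notMem_of_card_lt_card (s := s.image f ∪
        (s.image (edgeSum par f)).image fun t => t - f (par a)) (t := univ) (by
      refine (card_union_le _ _).trans_lt ?_
      rw [card_univ]
      have h1 : #(s.image f) ≤ #s := card_image_le
      have h2 : #((s.image (edgeSum par f)).image fun t => t - f (par a)) ≤ #s :=
        card_image_le.trans card_image_le
      omega)
    simp only [mem_union, mem_image, not_or, not_exists, not_and] at hu
    obtain ⟨hu1, hu2⟩ := hu
    have hff : ∀ w ∈ s, Function.update f a u w = f w := fun w hw =>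
      Function.update_of_ne (fun h : w = a => ha (h ▸ hw)) _ _
    refine ⟨Function.update f a u, ?_, ?_⟩
    · intro v hv w hw hvw
      simp only [coe_insert, Set.mem_insert_iff, mem_coe] at hv hw
      rcases hv with rfl | hv <;> rcases hw with rfl | hw
      · rfl
      · rw [Function.update_self, hff w hw] at hvw
        exact absurd hvw.symm (hu1 w hw)
      · rw [Function.update_self, hff v hv] at hvw
        exact absurd hvw (hu1 v hv)
      · rw [hff v hv, hff w hw] at hvw
        exact hf hv hw hvw
    · have hnew : par a ∈ s → ∀ w ∈ settled par r s,
          edgeSum par (Function.update f a u) w ≠ edgeSum par (Function.update f a u) a := by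
        intro hpa w hw hwa
        obtain ⟨h1, -, h2⟩ := mem_settled.1 hw
        simp only [edgeSum, Function.update_self, hff w h1, hff _ h2, hff _ hpa] at hwa
        exact hu2 _ ⟨w, h1, rfl⟩ (by rw [edgeSum, hwa, add_sub_cancel_right])
      intro v hv w hw hvw
      rcases hset v hv with hv' | ⟨rfl, hpa⟩ <;> rcases hset w hw with hw' | ⟨rfl, hpa'⟩
      · rw [IsPartialLabeling.edgeSum_eq hff hv', IsPartialLabeling.edgeSum_eq hff hw'] at hvw
        exact hs hv' hw' hvw
      · exact absurd hvw (hnew hpa' v hv')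
      · exact absurd hvw.symm (hnew hpa w hw')
      · rfl

lemma energyBound_le {C m : ℝ} (hC : 0 ≤ C) (hm : 0 < m) {n : ℕ} (hn : (n : ℝ) ≤ m) :
    energyBound C m (200000 * m ^ 2) n ≤ Real.exp C * (200144 * m ^ 2) := by
  have h1 : (1 + C / m) ^ n ≤ Real.exp C := by
    calc (1 + C / m) ^ n ≤ Real.exp (C / m) ^ n := by
          gcongr
          rw [add_comm]
          exact Real.add_one_le_exp _
      _ = Real.exp (n * (C / m)) := (Real.exp_nat_mul _ _).symm
      _ ≤ Real.exp C := by
          gcongr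
          calc n * (C / m) ≤ m * (C / m) := by gcongr
            _ = C := by field_simp
  have h2 : 144 * m * n ≤ 144 * m * m := by gcongr
  rw [energyBound]
  gcongr
  linarith

/-- A skeleton of a rooted tree can be labelled, together with all neighbouring vertices, such that
the unused labels and sums are pseudorandom and a reserve remains. -/
lemma exists_initial_labeling {ε α ω : ℝ} (hε : 0 < ε) (hε1 : ε ≤ 1) (hα : α = ε / 64)
    (hω : ω = α ^ 5 / 4096) (hm : 432 ≤ (ω * α ^ 2 / 64) ^ 4 * Fintype.card Γ)
    (hm' : 4 ≤ ω * Fintype.card Γ)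
    {par : V → V} {dep : V → ℕ} {r : V} (hdep : ∀ v, v ≠ r → dep v = dep (par v) + 1)
    {Z : Finset V} (hZ : IsSkeleton par r Z) (hZc : #Z ≤ ω / 88 * Fintype.card Γ)
    (hV : Fintype.card V ≤ (1 - ε) * Fintype.card Γ) :
    ∃ (A B X E E' U S : Finset Γ) (P : Finset V) (f : V → Γ) (W : Finset V),
      IsPartialLabeling par r Z A B X E E' P f W U S ∧
      IsReserve A B X ⌊ω * Fintype.card Γ⌋₊ ∧ X ⊆ E ∧ Disjoint A U ∧ Disjoint B S ∧
      (∀ z ∈ Z, z ∈ W ∧ par z ∈ W ∧ par (par z) ∈ W) ∧ (∀ v, par v ∈ Z → v ∈ P) ∧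
      ε / 2 * Fintype.card Γ + #Pᶜ ≤ #U ∧ ε / 2 * Fintype.card Γ + #Pᶜ ≤ #S ∧
      energy (bal U) + energy (bal S) ≤ 200000 * Fintype.card Γ ^ 2 ∧
      #W + #(E ∩ U) + #(E' ∩ S) + ω / 4 * Fintype.card Γ ≤ (⌊ω * Fintype.card Γ⌋₊ : ℝ) := by
  have hm0 : (0 : ℝ) < Fintype.card Γ := by exact_mod_cast Fintype.card_pos
  set m : ℝ := (Fintype.card Γ : ℝ) with hmdef
  have hα0 : 0 < α := by rw [hα]; positivity
  have hα1 : α ≤ 1 / 64 := by rw [hα]; linarith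
  have hω0 : 0 < ω := by rw [hω]; positivity
  have hω4 : ω ≤ α ^ 4 / 128 := by
    rw [hω]
    have : α ^ 5 ≤ α ^ 4 := pow_le_pow_of_le_one hα0.le (by linarith) (by norm_num)
    have h4 : 0 < α ^ 4 := by positivity
    linarith
  have hω1 : ω ≤ 1 := by
    have : α ^ 4 ≤ 1 := pow_le_one₀ hα0.le (by linarith)
    linarith
  have hωm : 0 < ω * m := by positivity
  have hm2 : 432 ≤ (α / 16) ^ 4 * m := by
    have h1 : ω * α ^ 2 ≤ 1 * α ^ 1 := by
      gcongr ?_ * ?_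
      exact pow_le_pow_of_le_one hα0.le (by linarith) (by norm_num)
    rw [one_mul, pow_one] at h1
    exact hm.trans (mul_le_mul_of_nonneg_right
      (pow_le_pow_left₀ (by positivity) (by linarith) 4) hm0.le)
  obtain ⟨f, hf, hfs⟩ := exists_greedy_labeling (Γ := Γ) hdep Z (by
    have h1 : ω / 88 * m ≤ 1 / 88 * m := by gcongr
    have h2 : (2 * #Z : ℝ) ≤ Fintype.card Γ := by rw [← hmdef]; linarith
    exact_mod_cast h2)
  set Y := Z.image f with hY
  have hYc : #Y ≤ #Z := card_image_le
  have hYc' : (#Y : ℝ) ≤ #Z := by exact_mod_cast hYc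
  have hFmem : ∀ v ∈ nextLayer par Z Z, par v ∈ Z := fun v hv => (mem_filter.1 hv).2.1
  have hFV : (#(nextLayer par Z Z) : ℝ) ≤ Fintype.card V := by exact_mod_cast card_le_univ _
  obtain ⟨A, B, U, S, I', hI', u, hAU, hBS, hu, hus, huU, hfail, hA, hB, hU, hS, hE, hEB, hYA⟩ :=
    exists_foundation hε hε1 hα hm2 Y (by
      calc (#Y : ℝ) ≤ ω / 88 * m := hYc'.trans hZc
        _ ≤ ω * m := by linarith
        _ ≤ α ^ 4 / 128 * m := by gcongr) (nextLayer par Z Z) (fun v => f (par v))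
      (fun v hv => mem_image_of_mem f (hFmem v hv)) (hFV.trans hV)
  obtain ⟨X, hXc, hXY, hR1, hR2⟩ := exists_reserve hα0 (by linarith) hω0 hω.le hm hm' hA hB hEB
  have hLfloor : (⌊ω * m⌋₊ : ℝ) ≤ ω * m := Nat.floor_le hωm.le
  have hLfloor' : ω * m - 1 ≤ (⌊ω * m⌋₊ : ℝ) := (Nat.sub_one_lt_floor _).le
  have hcast : ∀ F : Finset Γ, #F ≤ ⌊ω * m⌋₊ → (#F : ℝ) ≤ ω * m := fun F hF =>
    le_trans (Nat.cast_le.2 hF) hLfloor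
  have hR : IsReserve A B X ⌊ω * m⌋₊ :=
    ⟨fun F G hF hG => hR1 F G (hcast F hF) (hcast G hG),
      fun F G hF hG => hR2 F G (hcast F hF) (hcast G hG)⟩
  set W₀ := Z ∪ (Z.image par ∪ (Z.image par).image par) with hW₀
  have hWZ : ∀ z ∈ Z, z ∈ W₀ ∧ par z ∈ W₀ ∧ par (par z) ∈ W₀ := fun z hz => by
    simp only [hW₀, mem_union]
    exact ⟨Or.inl hz, Or.inr (Or.inl (mem_image_of_mem _ hz)),
      Or.inr (Or.inr (mem_image_of_mem _ (mem_image_of_mem _ hz)))⟩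
  have hW₀c : #W₀ ≤ #Z + (#Z + #Z) := by
    refine (card_union_le _ _).trans (Nat.add_le_add_left ((card_union_le _ _).trans ?_) _)
    exact Nat.add_le_add card_image_le (card_image_le.trans card_image_le)
  set E := Y ∪ X with hEdef
  set E' := (settled par r Z).image (edgeSum par f) with hE'def
  have hEc : #E ≤ #Z + #X := (card_union_le _ _).trans (Nat.add_le_add_right hYc _)
  have hE'c : #E' ≤ #Z := card_image_le.trans (card_filter_le _ _)
  have hstart : IsPartialLabeling par r Z A B X E E' Z f W₀ U S :=
    { subset := le_rfl
      par_mem := fun v hv hv' => absurd hv hv'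
      connector_mem := fun z hz hpz hppz => absurd hppz (hZ.gap z hz hpz)
      injOn := hf
      sum_injOn := hfs
      notMem := fun v hv => hXY _ (hYA _ (mem_image_of_mem f hv))
      mem_of_label := fun v hv _ => (hWZ v hv).1
      mem_of_sum := fun v hv _ => (hWZ v (mem_settled.1 hv).1).1
      label_mem := fun v hv _ => mem_union_left _ (mem_image_of_mem f hv)
      sum_mem := fun v hv _ => mem_image_of_mem _ hv }
  have hc1 : #{i ∈ I' | u i ∈ E} ≤ #E := by
    rw [← card_image_of_injOn (hu.mono (coe_subset.2 (filter_subset _ _)))]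
    exact card_le_card fun y hy => by
      obtain ⟨i, hi, rfl⟩ := mem_image.1 hy
      exact (mem_filter.1 hi).2
  have hc2 : #{i ∈ I' | f (par i) + u i ∈ E'} ≤ #E' := by
    rw [← card_image_of_injOn (hus.mono (coe_subset.2 (filter_subset _ _)))]
    exact card_le_card fun y hy => by
      obtain ⟨i, hi, rfl⟩ := mem_image.1 hy
      exact (mem_filter.1 hi).2
  have hsum : #W₀ + (#(nextLayer par Z Z \ I') + #{i ∈ I' | u i ∈ E} +
      #{i ∈ I' | f (par i) + u i ∈ E'}) ≤ 9 * #Z + #X := by omega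
  have hsum' : (9 * #Z + #X : ℝ) ≤ ⌊ω * m⌋₊ := by linarith
  obtain ⟨P, f', W, hZP, hP, hWW, hWc, h'⟩ := hstart.exists_stage hZ hR subset_union_right hWZ
    le_rfl le_rfl hAU hBS hI' hu hus
    (fun i hi => ⟨(huU i hi).1, (huU i hi).2.1, (huU i hi).2.2⟩)
    (fun i hi v hv hvi => hvi ▸ mem_union_left _ (mem_image_of_mem f hv))
    (fun i hi v hv hvi => hvi ▸ mem_image_of_mem _ hv) (by
      have h2 : 9 * #Z + #X ≤ ⌊ω * m⌋₊ := by exact_mod_cast hsum'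
      omega)
  have hPc : #Pᶜ + #(nextLayer par Z Z) ≤ Fintype.card V := by
    rw [← card_union_of_disjoint]
    · exact card_le_univ _
    · exact disjoint_left.2 fun v hv hv' => mem_compl.1 hv (hP v (hFmem v hv'))
  have hPc' : (#Pᶜ + #(nextLayer par Z Z) : ℝ) ≤ Fintype.card V := by exact_mod_cast hPc
  have hpot : #W + #(E ∩ U) + #(E' ∩ S) ≤ 11 * #Z + 2 * #X := by
    have h1 : #(E ∩ U) ≤ #E := card_le_card inter_subset_left
    have h2 : #(E' ∩ S) ≤ #E' := card_le_card inter_subset_left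
    omega
  have hpot' : (#W + #(E ∩ U) + #(E' ∩ S) : ℝ) ≤ 11 * #Z + 2 * #X := by exact_mod_cast hpot
  refine ⟨A, B, X, E, E', U, S, P, f', W, h', hR, subset_union_right, hAU, hBS, fun z hz =>
    ⟨hWW (hWZ z hz).1, hWW (hWZ z hz).2.1, hWW (hWZ z hz).2.2⟩, hP, by linarith, by linarith, hE,
    by linarith⟩

/-- Harmonious labelling of large rooted trees given by parent maps. -/
lemma exists_harmonious_of_parent {ε : ℝ} (hε : 0 < ε) (hε1 : ε ≤ 1) :
    ∃ N : ℕ, ∀ {V Γ : Type} [Fintype V] [DecidableEq V] [AddCommGroup Γ] [Fintype Γ]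
      [DecidableEq Γ] (par : V → V) (dep : V → ℕ) (r : V), par r = r →
      (∀ v, v ≠ r → dep v = dep (par v) + 1) → N ≤ Fintype.card V →
      (Fintype.card V : ℝ) ≤ (1 - ε) * Fintype.card Γ →
      ∃ f : V → Γ, Function.Injective f ∧ Set.InjOn (edgeSum par f) {v | v ≠ r} := by
  set α : ℝ := ε / 64 with hα
  have hα0 : 0 < α := by positivity
  set ω : ℝ := α ^ 5 / 4096 with hω
  have hω0 : 0 < ω := by positivity
  obtain ⟨K, hK⟩ := exists_skeleton (by positivity : 0 < ω / 88)
  set θ : ℝ := ω / (4 * (2 * K + 1)) with hθ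
  have hθ0 : 0 < θ := by positivity
  set ρ : ℝ := ε / 2 with hρ
  have hρ0 : 0 < ρ := by positivity
  set p : ℝ := ρ ^ 2 * θ / 2 with hp
  have hp0 : 0 < p := by positivity
  set Δ : ℝ := K + 1 with hΔ
  have hΔ1 : 1 ≤ Δ := by rw [hΔ]; linarith [(Nat.cast_nonneg K : (0 : ℝ) ≤ K)]
  have hΔ0 : 0 < Δ := by linarith
  set C : ℝ := 8 * Δ / p with hC
  have hC0 : 0 ≤ C := by positivity
  set η : ℝ := p ^ 4 / Δ with hη
  have hη0 : 0 < η := by positivity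
  have hpp : 2 * p = ρ ^ 2 * θ := by rw [hp]; ring
  have hΔη : Δ * η ≤ p ^ 4 := le_of_eq (by rw [hη]; field_simp)
  obtain ⟨N, hN⟩ := exists_nat_ge (K + 432 / (ω * α ^ 2 / 64) ^ 4 + 4 / ω +
    Real.exp C * 200144 / η : ℝ)
  have hq1 : (0 : ℝ) ≤ K := by positivity
  have hq2 : 0 ≤ 432 / (ω * α ^ 2 / 64) ^ 4 := by positivity
  have hq3 : 0 ≤ 4 / ω := by positivity
  have hq4 : 0 ≤ Real.exp C * 200144 / η := by positivity
  refine ⟨N, fun {V Γ} _ _ _ _ _ par dep r hr hdep hNV hVΓ => ?_⟩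
  have hm0 : (0 : ℝ) < Fintype.card Γ := by exact_mod_cast Fintype.card_pos
  have hVm : (Fintype.card V : ℝ) ≤ Fintype.card Γ := by nlinarith
  have hNV' : (N : ℝ) ≤ Fintype.card V := by exact_mod_cast hNV
  have hKV : K ≤ Fintype.card V := by
    have : (K : ℝ) ≤ Fintype.card V := by linarith
    exact_mod_cast this
  obtain ⟨Z, hrZ, hZc, hdeg, hreach, hgap, hinj⟩ := hK par dep r hr hdep hKV
  have hZ : IsSkeleton par r Z := ⟨hr, hrZ, hgap, hinj⟩
  have hm1 : 432 ≤ (ω * α ^ 2 / 64) ^ 4 * Fintype.card Γ := by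
    rw [← div_le_iff₀' (by positivity)]; linarith
  have hm2 : 4 ≤ ω * Fintype.card Γ := by
    rw [← div_le_iff₀' hω0]; linarith
  have hm3 : Real.exp C * 200144 ≤ η * Fintype.card Γ := by
    rw [← div_le_iff₀' hη0]; linarith
  obtain ⟨A, B, X, E, E', U, S, P, f, W, h, hR, hXE, hAU, hBS, hWZ, hZP, hU, hS, hE, hpot⟩ :=
    exists_initial_labeling (Γ := Γ) hε hε1 hα hω hm1 hm2 hdep hZ
      (hZc.trans (mul_le_mul_of_nonneg_left hVm (by positivity))) hVΓ
  have hJθ : ((2 * K : ℕ) : ℝ) * (θ * Fintype.card Γ) ≤ ω / 4 * Fintype.card Γ := by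
    have h1 : ω / 4 = (2 * K + 1) * θ := by rw [hθ]; field_simp
    rw [h1]
    push_cast
    nlinarith [mul_pos hθ0 hm0]
  obtain ⟨P', f', W', U', S', k, h', -, -, -, -, -, -, -, -, -, hall⟩ :=
    h.exists_layers hZ hR hXE hAU hBS hWZ hZP hΔ1 hp0 hρ0.le hθ0.le hpp hΔη hC (by positivity) (by
        refine (energyBound_le hC0 hm0 hVm).trans ?_
        calc Real.exp C * (200144 * (Fintype.card Γ : ℝ) ^ 2) =
              (Real.exp C * 200144) * (Fintype.card Γ : ℝ) ^ 2 := by ring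
          _ ≤ (η * Fintype.card Γ) * (Fintype.card Γ : ℝ) ^ 2 := by gcongr
          _ = _ := by ring)
      (fun v hv => by
        have : (#{u | u ≠ r ∧ par u = v} : ℝ) ≤ K := by exact_mod_cast hdeg v hv
        linarith) (by exact_mod_cast hVm) hU hS hE (J := 2 * K) (by linarith) le_rfl
  have huniv : ∀ v, v ∈ P' := fun v => by
    obtain ⟨i, hi, hv⟩ := hreach v
    exact hall v i hi hv
  refine ⟨f', fun v w hvw => h'.injOn (huniv v) (huniv w) hvw, fun v hv w hw hvw =>
    h'.sum_injOn (mem_settled.2 ⟨huniv v, hv, huniv _⟩) (mem_settled.2 ⟨huniv w, hw, huniv _⟩) hvw⟩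

end Main

/-- A tree can be described by the parents and depths of its vertices with respect to a root. -/
lemma SimpleGraph.IsTree.exists_parent {n : ℕ} {T : SimpleGraph (Fin n)} (hT : T.IsTree)
    (r : Fin n) : ∃ (par : Fin n → Fin n) (dep : Fin n → ℕ), par r = r ∧
      (∀ v, v ≠ r → dep v = dep (par v) + 1) ∧
      ∀ e ∈ T.edgeSet, ∃ v, v ≠ r ∧ e = s(v, par v) := by
  classical
  have hstep : ∀ v, ∃ w, (v = r → w = r) ∧
      (v ≠ r → T.Adj v w ∧ T.dist v r = T.dist w r + 1) := by
    intro v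
    rcases eq_or_ne v r with rfl | hv
    · exact ⟨v, fun _ => rfl, fun h => absurd rfl h⟩
    obtain ⟨q, hq⟩ := hT.1.exists_walk_length_eq_dist v r
    cases q with
    | nil => exact absurd rfl hv
    | @cons _ w _ h q =>
      refine ⟨w, fun h => absurd h hv, fun _ => ⟨h, ?_⟩⟩
      rw [SimpleGraph.Walk.length_cons] at hq
      have h1 := SimpleGraph.dist_le q
      have h2 := hT.1.dist_triangle (u := v) (v := w) (w := r)
      rw [SimpleGraph.dist_eq_one_iff_adj.2 h] at h2
      omega
  choose par hpr hpar using hstep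
  refine ⟨par, fun v => T.dist v r, hpr r rfl, fun v hv => (hpar v hv).2, fun e he => ?_⟩
  have hsub : (univ.erase r).image (fun v => s(v, par v)) ⊆ T.edgeFinset := fun e he => by
    obtain ⟨v, hv, rfl⟩ := mem_image.1 he
    exact SimpleGraph.mem_edgeFinset.2 (hpar v (ne_of_mem_erase hv)).1
  have hinj : Set.InjOn (fun v => s(v, par v)) (univ.erase r : Finset (Fin n)) := by
    intro v hv w hw hvw
    rcases Sym2.eq_iff.1 hvw with h | ⟨h1, h2⟩
    · exact h.1
    · have h3 := (hpar v (ne_of_mem_erase hv)).2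
      have h4 := (hpar w (ne_of_mem_erase hw)).2
      rw [h2] at h3
      rw [← h1] at h4
      omega
  have hcard := hT.card_edgeFinset
  have heq := eq_of_subset_of_card_le hsub (by
    rw [card_image_of_injOn hinj, card_erase_of_mem (mem_univ _), card_univ]
    omega)
  rw [← SimpleGraph.mem_edgeFinset, ← heq] at he
  obtain ⟨v, hv, rfl⟩ := mem_image.1 he
  exact ⟨v, ne_of_mem_erase hv, rfl⟩

end Helpers

/-- every large tree is almost harmonious: For every `ε > 0` and every
sufficiently large `n`, every tree `T` on `n` vertices has an injective `Γ`-harmonious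
labeling for every finite abelian group `Γ` of order at least `(1 + ε) n`: an injective
`f : V(T) → Γ` such that `{x, y} ↦ f x + f y` is injective on the edges of `T`. -/
theorem harmonious_labeling_trees (ε : ℝ) (hε : 0 < ε) :
    ∃ n₀ : ℕ, ∀ n : ℕ, n₀ ≤ n →
      ∀ T : SimpleGraph (Fin n), T.IsTree →
        ∀ (Γ : Type) [AddCommGroup Γ] [Fintype Γ],
          (1 + ε) * (n : ℝ) ≤ (Fintype.card Γ : ℝ) →
          ∃ f : Fin n → Γ, Function.Injective f ∧
            Set.InjOn (labelSum f) T.edgeSet := by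
  classical
  have hε' : 0 < ε / (1 + ε) := by positivity
  obtain ⟨N, hN⟩ := exists_harmonious_of_parent hε' (by rw [div_le_one (by positivity)]; linarith)
  refine ⟨N, fun n hn T hT Γ _ _ hΓ => ?_⟩
  obtain ⟨r⟩ := hT.1.nonempty
  obtain ⟨par, dep, hr, hdep, hedge⟩ := hT.exists_parent r
  obtain ⟨f, hf, hs⟩ := hN (Γ := Γ) par dep r hr hdep (by simpa using hn) (by
    have h1 : 1 - ε / (1 + ε) = 1 / (1 + ε) := by field_simp; ring
    rw [h1, Fintype.card_fin, one_div_mul_eq_div, le_div_iff₀ (by positivity), mul_comm]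
    exact hΓ)
  refine ⟨f, hf, fun e he e' he' hee => ?_⟩
  obtain ⟨v, hv, rfl⟩ := hedge e he
  obtain ⟨w, hw, rfl⟩ := hedge e' he'
  rw [hs hv hw hee]
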